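/- arXiv:2112.12450 — 9 statements merged into one kernel-verified Lean document; each statement's English description precedes it below -/
import Mathlib

section
/- Let Ω be any set of complex numbers each of which is algebraic over ℚ and with 0 ∉ Ω. Then every nonzero element of the additive subgroup of ℂ generated by the set {exp(a) : a ∈ Ω} is transcendental over ℚ; that is, this subgroup is a transcendental group. -/
namespace Polynomial

theorem isIntegral_leadingCoeff_pow_mul_aeval {K : Type*} [Field K] (f g : ℤ[X]) {a : K}
    (ha : aeval a f = 0) {m : ℕ} (hg : g.natDegree ≤ m) :
    IsIntegral ℤ ((f.leadingCoeff : K) ^ m * aeval a g) := by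
  have hL : IsIntegral ℤ ((f.leadingCoeff : K) * a) := by
    simpa [zsmul_eq_mul] using isIntegral_leadingCoeff_smul f a ha
  rw [aeval_eq_sum_range' (Nat.lt_succ_of_le hg), Finset.mul_sum]
  refine IsIntegral.sum _ fun i hi => ?_
  have him : i ≤ m := Nat.lt_succ_iff.mp (Finset.mem_range.mp hi)
  have : (f.leadingCoeff : K) ^ m * g.coeff i • a ^ i =
      ((g.coeff i * f.leadingCoeff ^ (m - i) : ℤ) : K) * ((f.leadingCoeff : K) * a) ^ i := by
    rw [← Nat.sub_add_cancel him, pow_add, Nat.sub_add_cancel him, zsmul_eq_mul]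
    push_cast
    ring
  rw [this]
  exact (isIntegral_algebraMap (R := ℤ) (x := g.coeff i * f.leadingCoeff ^ (m - i))).mul (hL.pow i)

theorem exists_int_eval_zero_ne_zero_forall_aeval_eq_zero {K : Type*} [Field K]
    [Algebra ℚ K] [Algebra.IsAlgebraic ℚ K] (S : Finset K) (hS : 0 ∉ S) :
    ∃ f : ℤ[X], f.eval 0 ≠ 0 ∧ ∀ a ∈ S, aeval a f = 0 := by
  have h (a : K) : ∃ q : ℤ[X], a ≠ 0 → q.coeff 0 ≠ 0 ∧ aeval a q = 0 := by
    by_cases ha : a = 0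
    · exact ⟨0, fun h => (h ha).elim⟩
    · have hint : IsAlgebraic ℤ a :=
        (IsFractionRing.isAlgebraic_iff ℤ ℚ K).mpr (Algebra.IsAlgebraic.isAlgebraic a)
      obtain ⟨q, hq⟩ :=
        hint.exists_nonzero_coeff_and_aeval_eq_zero (mem_nonZeroDivisors_of_ne_zero ha)
      exact ⟨q, fun _ => hq⟩
  choose q hq using h
  have hne {a : K} (ha : a ∈ S) : a ≠ 0 := fun h => hS (h ▸ ha)
  refine ⟨∏ a ∈ S, q a, ?_, fun a ha => ?_⟩
  · rw [eval_prod, Finset.prod_ne_zero_iff]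
    intro a ha
    rw [← coeff_zero_eq_eval_zero]
    exact (hq a (hne ha)).1
  · rw [map_prod]
    exact Finset.prod_eq_zero ha (hq a (hne ha)).2

end Polynomial

namespace LindemannWeierstrass

open Polynomial
open scoped Nat

/-- The homomorphism `∑ nᵢ [aᵢ] ↦ ∑ nᵢ exp (f aᵢ)` from the integral group algebra of an additive
group to the complex numbers. -/
noncomputable def expEval {A : Type*} [AddCommGroup A] (f : A →+ ℂ) :
    AddMonoidAlgebra ℤ A →ₐ[ℤ] ℂ :=
  AddMonoidAlgebra.lift ℤ ℂ A
    { toFun := fun a => Complex.exp (f a.toAdd)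
      map_one' := by simp
      map_mul' := fun a b => by simp [Complex.exp_add] }

theorem expEval_single {A : Type*} [AddCommGroup A] (f : A →+ ℂ) (a : A) (n : ℤ) :
    expEval f (AddMonoidAlgebra.single a n) = n * Complex.exp (f a) := by
  simp [expEval]

theorem expEval_apply {A : Type*} [AddCommGroup A] (f : A →+ ℂ) (x : AddMonoidAlgebra ℤ A) :
    expEval f x = ∑ a ∈ x.coeff.support, x.coeff a * Complex.exp (f a) := by
  simp [expEval, AddMonoidAlgebra.lift_apply, Finsupp.sum]

/-- The action of a field automorphism on the integral group algebra of the additive group. -/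
noncomputable def galAct {K : Type*} [Field K] [Algebra ℚ K]
    (σ : K ≃ₐ[ℚ] K) :
    AddMonoidAlgebra ℤ K ≃ₐ[ℤ] AddMonoidAlgebra ℤ K :=
  AddMonoidAlgebra.domCongr ℤ ℤ σ.toAddEquiv

theorem coeff_galAct {K : Type*} [Field K] [Algebra ℚ K]
    (σ : K ≃ₐ[ℚ] K) (x : AddMonoidAlgebra ℤ K) (a : K) :
    (galAct σ x).coeff a = x.coeff (σ.symm a) := by
  simp [galAct]

theorem galAct_galAct {K : Type*} [Field K] [Algebra ℚ K]
    (σ τ : K ≃ₐ[ℚ] K) (x : AddMonoidAlgebra ℤ K) :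
    galAct σ (galAct τ x) = galAct (σ * τ) x := by
  ext a
  simp only [coeff_galAct]
  rfl

variable {K : Type*} [Field K] [Algebra ℚ K] [FiniteDimensional ℚ K] [IsGalois ℚ K]

theorem exists_int_eq_of_isIntegral_of_fixed {x : K} (hx : IsIntegral ℤ x)
    (hfix : ∀ σ : K ≃ₐ[ℚ] K, σ x = x) : ∃ z : ℤ, (z : K) = x := by
  obtain ⟨q, rfl⟩ := (IsGalois.mem_range_algebraMap_iff_fixed x).mpr hfix
  have hq : IsIntegral ℤ q := (isIntegral_algebraMap_iff (algebraMap ℚ K).injective).mp hx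
  obtain ⟨z, rfl⟩ := IsIntegrallyClosed.isIntegral_iff.mp hq
  exact ⟨z, by simp⟩

theorem coeff_zero_eq_zero_of_invariant (ψ : K →+* ℂ) (W : AddMonoidAlgebra ℤ K)
    (hinv : ∀ (σ : K ≃ₐ[ℚ] K) (a : K), W.coeff (σ a) = W.coeff a)
    (hW : expEval (ψ : K →+ ℂ) W = 0) : W.coeff 0 = 0 := by
  classical
  by_contra hw0
  set w := W.coeff
  set S := w.support.erase 0 with hS
  obtain ⟨f, hf0, hfS⟩ := exists_int_eval_zero_ne_zero_forall_aeval_eq_zero S (by simp [hS])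
  have hf : f ≠ 0 := by rintro rfl; simp at hf0
  have hsum : (w 0 : ℂ) + ∑ a ∈ S, (w a : ℂ) * Complex.exp (ψ a) = 0 := by
    rw [expEval_apply, ← Finset.add_sum_erase _ _ (Finsupp.mem_support_iff.mpr hw0)] at hW
    simpa using hW
  obtain ⟨c, hc⟩ := exp_polynomial_approx f hf0
  set L := f.leadingCoeff
  have hL0 : L ≠ 0 := leadingCoeff_ne_zero.mpr hf
  set d := f.natDegree
  set B : ℝ := ∑ a ∈ S, |(w a : ℝ)| with hB
  obtain ⟨N, hN⟩ := Filter.eventually_atTop.mp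
    (FloorSemiring.eventually_mul_pow_lt_factorial_sub B (|(L : ℝ)| ^ d * c) 1)
  obtain ⟨p, hpN, hp⟩ := Nat.exists_infinite_primes
    (N + ((f.eval 0).natAbs + L.natAbs + (w 0).natAbs + 1))
  obtain ⟨n, hn, g, hg, hr⟩ := hc p (by omega) hp
  have hfix (σ : K ≃ₐ[ℚ] K) :
      σ (∑ a ∈ S, (w a : K) * ((L : K) ^ (p * d) * aeval a g)) =
        ∑ a ∈ S, (w a : K) * ((L : K) ^ (p * d) * aeval a g) := by
    rw [map_sum]
    refine Finset.sum_bij' (fun a _ => σ a) (fun a _ => σ.symm a) ?_ ?_ ?_ ?_ ?_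
    · intro a ha
      simpa [hS, hinv] using ha
    · intro a ha
      have := hinv σ.symm a
      simpa [hS, this] using ha
    · simp
    · simp
    · intro a _
      have : σ (aeval a g) = aeval (σ a) g :=
        (aeval_algHom_apply (σ.toAlgHom.restrictScalars ℤ) a g).symm
      simp [hinv, this]
  have hint : IsIntegral ℤ (∑ a ∈ S, (w a : K) * ((L : K) ^ (p * d) * aeval a g)) :=
    IsIntegral.sum _ fun a ha => (isIntegral_algebraMap (R := ℤ) (x := w a)).mul
      (isIntegral_leadingCoeff_pow_mul_aeval f g (hfS a ha) (hg.trans (Nat.sub_le _ _)))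
  obtain ⟨z, hz⟩ := exists_int_eq_of_isIntegral_of_fixed hint hfix
  have hzC : (z : ℂ) = ∑ a ∈ S, (w a : ℂ) * ((L : ℂ) ^ (p * d) * aeval (ψ a) g) := by
    have := congrArg ψ hz
    rw [map_sum] at this
    rw [← map_intCast ψ z, this]
    refine Finset.sum_congr rfl fun a _ => ?_
    have : ψ (aeval a g) = aeval (ψ a) g :=
      (aeval_algHom_apply ψ.toIntAlgHom a g).symm
    simp [this]
  have hT : ((L ^ (p * d) * (n * w 0) + p * z : ℤ) : ℂ) =
      -((L : ℂ) ^ (p * d) *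
        ∑ a ∈ S, (w a : ℂ) * (n • Complex.exp (ψ a) - p • aeval (ψ a) g)) := by
    have hw0' : (w 0 : ℂ) = -∑ a ∈ S, (w a : ℂ) * Complex.exp (ψ a) :=
      eq_neg_of_add_eq_zero_left hsum
    push_cast
    rw [hzC, hw0']
    simp only [zsmul_eq_mul, nsmul_eq_mul, mul_neg, Finset.mul_sum, ← Finset.sum_neg_distrib,
      ← Finset.sum_add_distrib]
    refine Finset.sum_congr rfl fun a _ => ?_
    ring
  have hlt : ‖((L ^ (p * d) * (n * w 0) + p * z : ℤ) : ℂ)‖ < 1 := by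
    have hfac : (0 : ℝ) < ((p - 1)! : ℕ) := by exact_mod_cast Nat.factorial_pos _
    calc ‖((L ^ (p * d) * (n * w 0) + p * z : ℤ) : ℂ)‖
        ≤ |(L : ℝ)| ^ (p * d) * ∑ a ∈ S, |(w a : ℝ)| * (c ^ p / (p - 1)!) := by
          rw [hT, norm_neg, norm_mul, norm_pow, Complex.norm_intCast]
          refine mul_le_mul_of_nonneg_left ?_ (by positivity)
          refine norm_sum_le_of_le _ fun a ha => ?_
          rw [norm_mul, Complex.norm_intCast]
          refine mul_le_mul_of_nonneg_left (hr ?_) (abs_nonneg _)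
          rw [mem_aroots]
          refine ⟨hf, ?_⟩
          have : ψ (aeval a f) = aeval (ψ a) f := (aeval_algHom_apply ψ.toIntAlgHom a f).symm
          rw [← this, hfS a ha, map_zero]
      _ = B * (|(L : ℝ)| ^ d * c) ^ p / (p - 1)! := by
          rw [← Finset.sum_mul, mul_pow, ← pow_mul, mul_comm d p, hB]
          ring
      _ < 1 := by
          rw [div_lt_one hfac]
          exact hN p (by omega)
  have hT0 : L ^ (p * d) * (n * w 0) + p * z = 0 := by
    rw [Complex.norm_intCast] at hlt
    exact Int.abs_lt_one_iff.mp (by exact_mod_cast hlt)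
  have hdvd : (p : ℤ) ∣ L ^ (p * d) * (n * w 0) :=
    (dvd_add_left (dvd_mul_right _ z)).mp (hT0 ▸ dvd_zero _)
  have hp' := Nat.prime_iff_prime_int.mp hp
  have hsmall {m : ℤ} (hm : m ≠ 0) (hlt : m.natAbs < p) : ¬ (p : ℤ) ∣ m := fun h =>
    (Nat.le_of_dvd (Int.natAbs_pos.mpr hm) (Int.natCast_dvd.mp h)).not_gt hlt
  rcases hp'.dvd_or_dvd hdvd with h | h
  · exact hsmall hL0 (by omega) (hp'.dvd_of_dvd_pow h)
  · rcases hp'.dvd_or_dvd h with h | h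
    · exact hn h
    · exact hsmall hw0 (by omega) h

/-- The Lindemann–Weierstrass theorem with integer coefficients, for exponents in a finite Galois
extension of `ℚ`. -/
theorem eq_zero_of_expEval_eq_zero (ψ : K →+* ℂ) (Y : AddMonoidAlgebra ℤ K)
    (hY : expEval (ψ : K →+ ℂ) Y = 0) : Y = 0 := by
  by_contra hY0
  set Z := ∏ σ : K ≃ₐ[ℚ] K, galAct σ Y with hZ
  have hZ0 : Z ≠ 0 := Finset.prod_ne_zero_iff.mpr fun σ _ => by simpa using hY0
  have hZinv (τ : K ≃ₐ[ℚ] K) : galAct τ Z = Z := by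
    simp only [hZ, map_prod, galAct_galAct]
    exact Fintype.prod_equiv (Equiv.mulLeft τ) _ _ fun _ => rfl
  have hZinv' (τ : K ≃ₐ[ℚ] K) (a : K) : Z.coeff (τ a) = Z.coeff a := by
    conv_lhs => rw [← hZinv τ, coeff_galAct]
    simp
  have hZeval : expEval (ψ : K →+ ℂ) Z = 0 := by
    rw [hZ, map_prod]
    refine Finset.prod_eq_zero (Finset.mem_univ 1) ?_
    have : galAct (1 : K ≃ₐ[ℚ] K) Y = Y := by ext a; rw [coeff_galAct]; rfl
    rw [this, hY]
  obtain ⟨s, hs⟩ : ∃ s, Z.coeff s ≠ 0 := by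
    by_contra! h
    exact hZ0 (by ext a; simp [h a])
  set W := Z * ∑ σ : K ≃ₐ[ℚ] K, AddMonoidAlgebra.single (-σ s) (1 : ℤ) with hW
  have hWcoeff (a : K) : W.coeff a = ∑ σ : K ≃ₐ[ℚ] K, Z.coeff (a + σ s) := by
    simp [hW, Finset.mul_sum, AddMonoidAlgebra.coeff_sum, Finsupp.finsetSum_apply]
  have hWinv (τ : K ≃ₐ[ℚ] K) (a : K) : W.coeff (τ a) = W.coeff a := by
    rw [hWcoeff, hWcoeff]
    refine (Fintype.sum_equiv (Equiv.mulLeft τ) _ _ fun σ => ?_).symm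
    rw [← hZinv' τ, map_add]
    rfl
  have hW0 := coeff_zero_eq_zero_of_invariant ψ W hWinv (by rw [hW, map_mul, hZeval, zero_mul])
  simp [hWcoeff, hZinv', hs] at hW0

theorem expEval_mapDomain {A B : Type*} [AddCommGroup A] [AddCommGroup B] (g : A →+ B)
    (f : B →+ ℂ) (x : AddMonoidAlgebra ℤ A) :
    expEval f (AddMonoidAlgebra.mapDomain g x) = expEval (f.comp g) x := by
  induction x using AddMonoidAlgebra.induction_linear with
  | zero => simp
  | add x y hx hy => rw [AddMonoidAlgebra.mapDomain_add, map_add, map_add, hx, hy]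
  | single a n => rw [AddMonoidAlgebra.mapDomain_single, expEval_single, expEval_single]; rfl

theorem expEval_injective_of_isAlgClosure {A : Type*} [Field A] [Algebra ℚ A] [IsAlgClosure ℚ A]
    (ψ : A →+* ℂ) : Function.Injective (expEval (ψ : A →+ ℂ)) := by
  rw [injective_iff_map_eq_zero]
  intro Y hY
  have : Normal ℚ A := IsAlgClosure.normal ℚ A
  have : IsGalois ℚ A := {}
  let K := FiniteGaloisIntermediateField.adjoin ℚ (Y.coeff.support : Set A)
  let _ : Algebra ℚ K := K.algebra'
  have : FiniteDimensional ℚ K := K.finiteDimensional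
  have : IsGalois ℚ K := K.isGalois
  have hsub : (Y.coeff.support : Set A) ⊆ Set.range ((K.val : K →+ A) : K → A) := by
    intro a ha
    exact ⟨⟨a, FiniteGaloisIntermediateField.subset_adjoin ℚ _ ha⟩, rfl⟩
  have hinj : Function.Injective ((K.val : K →+ A) : K → A) := Subtype.val_injective
  have hmap := AddMonoidAlgebra.mapDomain_comapDomain hsub hinj
  rw [← hmap, expEval_mapDomain] at hY
  rw [← hmap, eq_zero_of_expEval_eq_zero (ψ.comp (K.val : K →+* A)) _ hY,
    AddMonoidAlgebra.mapDomain_zero]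

end LindemannWeierstrass

namespace AddMonoidAlgebra

/-- Elements of the integral group algebra of a torsion-free abelian group with vanishing constant
term are not roots of integer polynomials with nonvanishing constant term. -/
theorem aeval_ne_zero_of_coeff_zero_eq_zero {A : Type*} [AddCommGroup A] [Module ℚ A]
    {x : AddMonoidAlgebra ℤ A} (hx : x.coeff 0 = 0) {P : Polynomial ℤ} (hP : P.coeff 0 ≠ 0) :
    Polynomial.aeval x P ≠ 0 := by
  intro h
  set y := mapRingHom A (Int.castRingHom ℂ) x with hy
  have hy0 : y.coeff 0 = 0 := by simp [hy, hx]
  set Q := P.map (Int.castRingHom ℂ) with hQ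
  have hQ0 : Q.coeff 0 ≠ 0 := by simpa [hQ] using hP
  have hQy : Polynomial.aeval y Q = 0 := by
    have := congrArg (mapRingHom A (Int.castRingHom ℂ)) h
    rw [map_zero] at this
    rw [← this, hQ, hy, ← RingHom.toIntAlgHom_coe (mapRingHom A (Int.castRingHom ℂ)),
      ← Polynomial.aeval_algHom_apply]
    exact Polynomial.aeval_map_algebraMap ℂ _ P
  have hsplit := (IsAlgClosed.splits Q).eq_prod_roots
  rw [hsplit, map_mul, map_multiset_prod, mul_eq_zero] at hQy
  have hne : Q ≠ 0 := by rintro h; simp [h] at hQ0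
  rcases hQy with h | h
  · simp [hne] at h
  · rw [Multiset.prod_eq_zero_iff, Multiset.map_map, Multiset.mem_map] at h
    obtain ⟨r, hr, h⟩ := h
    have h0 := congrArg (fun z => z.coeff 0) h
    simp [hy0] at h0
    subst h0
    exact hQ0 (by rw [Polynomial.coeff_zero_eq_eval_zero]; exact (Polynomial.mem_roots'.mp hr).2)

end AddMonoidAlgebra

theorem stmt6 (Ω : Set ℂ) (halg : ∀ a ∈ Ω, IsAlgebraic ℚ a) (h0 : 0 ∉ Ω) :
    ∀ g ∈ AddSubgroup.closure (Complex.exp '' Ω), g ≠ 0 → Transcendental ℚ g := by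
  intro g hg hg0 hgalg
  let A := algebraicClosure ℚ ℂ
  let _ : Algebra ℚ A := A.algebra'
  have : IsAlgClosure ℚ A := algebraicClosure.isAlgClosure ℚ ℂ
  let ψ : A →+* ℂ := algebraMap A ℂ
  obtain ⟨x, hx, rfl⟩ : ∃ x : AddMonoidAlgebra ℤ A, x.coeff 0 = 0 ∧
      LindemannWeierstrass.expEval (ψ : A →+ ℂ) x = g := by
    clear hg0 hgalg
    induction hg using AddSubgroup.closure_induction with
    | mem g hg =>
      obtain ⟨a, ha, rfl⟩ := hg
      have ha0 : a ≠ 0 := fun h => h0 (h ▸ ha)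
      refine ⟨.single ⟨a, (mem_algebraicClosure_iff).mpr (halg a ha)⟩ 1, ?_, ?_⟩
      · rw [AddMonoidAlgebra.coeff_single]
        exact Finsupp.single_eq_of_ne fun h => ha0 (congrArg Subtype.val h).symm
      · rw [LindemannWeierstrass.expEval_single]
        simp
        rfl
    | zero => exact ⟨0, rfl, map_zero _⟩
    | add x y _ _ hx hy =>
      obtain ⟨x, hx, rfl⟩ := hx
      obtain ⟨y, hy, rfl⟩ := hy
      exact ⟨x + y, by simp [hx, hy], map_add _ _ _⟩
    | neg x _ hx =>
      obtain ⟨x, hx, rfl⟩ := hx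
      exact ⟨-x, by simp [hx], map_neg _ _⟩
  obtain ⟨P, hP, hPg⟩ := ((IsFractionRing.isAlgebraic_iff ℤ ℚ ℂ).mpr
    hgalg).exists_nonzero_coeff_and_aeval_eq_zero (mem_nonZeroDivisors_of_ne_zero hg0)
  rw [Polynomial.aeval_algHom_apply] at hPg
  exact AddMonoidAlgebra.aeval_ne_zero_of_coeff_zero_eq_zero hx hP
    ((injective_iff_map_eq_zero _).mp
      (LindemannWeierstrass.expEval_injective_of_isAlgClosure ψ) _ hPg)
end

section
/- Let S be any set of nonzero complex numbers each of which is algebraic over ℚ, and let T = {log α : α ∈ S}, where log denotes the principal branch of the complex logarithm. Then every nonzero element of the additive subgroup of ℂ generated by T is transcendental over ℚ; that is, this subgroup is a transcendental group. -/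
open Polynomial in
theorem isIntegral_pow_smul_aeval {R A : Type*} [CommRing R] [CommRing A] [Algebra R A]
    {a : R} {x : A} (h : IsIntegral R (a • x)) (g : R[X]) {m : ℕ} (hm : g.natDegree ≤ m) :
    IsIntegral R (a ^ m • aeval x g) := by
  rw [aeval_eq_sum_range' (Nat.lt_succ_of_le hm), Finset.smul_sum]
  refine IsIntegral.sum _ fun i hi => ?_
  have hi : i ≤ m := Nat.lt_succ_iff.mp (Finset.mem_range.mp hi)
  have : a ^ m • g.coeff i • x ^ i = (a ^ (m - i) * g.coeff i) • (a • x) ^ i := by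
    rw [_root_.smul_pow, smul_smul, smul_smul]
    congr 1
    rw [← Nat.sub_add_cancel hi, pow_add, Nat.add_sub_cancel]
    ring
  rw [this]
  exact (h.pow i).smul _

theorem exists_prime_gt_mul_pow_div_factorial_lt_one (C B : ℝ) (k : ℕ) :
    ∃ p > k, p.Prime ∧ C * (B ^ p / (p - 1).factorial) < 1 := by
  have h : Filter.Tendsto (fun n : ℕ => C * B * (B ^ n / n.factorial)) Filter.atTop (nhds 0) := by
    simpa using (FloorSemiring.tendsto_pow_div_factorial_atTop B).const_mul (C * B)
  obtain ⟨m, hm⟩ := Filter.eventually_atTop.mp (h.eventually_lt_const one_pos)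
  obtain ⟨p, hp, hprime⟩ := Nat.exists_infinite_primes (max m k + 1)
  refine ⟨p, by omega, hprime, ?_⟩
  refine lt_of_eq_of_lt ?_ (hm (p - 1) (by omega))
  obtain ⟨q, rfl⟩ := Nat.exists_eq_succ_of_ne_zero hprime.ne_zero
  rw [Nat.succ_sub_one, pow_succ]
  ring

open Polynomial in
theorem exists_intPolynomial_eval_zero_ne_zero_and_aeval_eq_zero {K : Type*} [Field K] [CharZero K]
    (s : Finset K) (h0 : 0 ∉ s) (hs : ∀ x ∈ s, IsAlgebraic ℤ x) :
    ∃ f : ℤ[X], f.eval 0 ≠ 0 ∧ ∀ x ∈ s, aeval x f = 0 := by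
  classical
  induction s using Finset.induction_on with
  | empty => exact ⟨1, by simp, by simp⟩
  | insert x s hx ih =>
    obtain ⟨f, hf, hfs⟩ := ih (fun h => h0 (Finset.mem_insert_of_mem h))
      fun y hy => hs y (Finset.mem_insert_of_mem hy)
    have hx0 : x ≠ 0 := fun h => h0 (h ▸ Finset.mem_insert_self x s)
    obtain ⟨q, hq, hqx⟩ := (hs x (Finset.mem_insert_self x s)).exists_nonzero_coeff_and_aeval_eq_zero
      (mem_nonZeroDivisors_of_ne_zero hx0)
    refine ⟨q * f, ?_, fun y hy => ?_⟩
    · rw [eval_mul, ← coeff_zero_eq_eval_zero]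
      exact mul_ne_zero hq hf
    · rcases Finset.mem_insert.mp hy with rfl | hy
      · simp [hqx]
      · simp [hfs y hy]

section GroupRing

variable {K : Type*} [Field K] [Algebra ℚ K]

/-- The ring homomorphism from the group ring of `K` to `ℂ` sending the basis vector of `x`
to `exp x`. -/
noncomputable def expEval (ι : K →ₐ[ℚ] ℂ) : AddMonoidAlgebra ℤ K →ₐ[ℤ] ℂ :=
  AddMonoidAlgebra.lift ℤ ℂ K
    { toFun := fun x => Complex.exp (ι x.toAdd)
      map_one' := by simp
      map_mul' := fun x y => by simp [Complex.exp_add] }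

theorem expEval_single (ι : K →ₐ[ℚ] ℂ) (x : K) (m : ℤ) :
    expEval ι (AddMonoidAlgebra.single x m) = m * Complex.exp (ι x) := by
  simp [expEval]

theorem expEval_apply (ι : K →ₐ[ℚ] ℂ) (y : AddMonoidAlgebra ℤ K) :
    expEval ι y = y.coeff.sum fun x m => (m : ℂ) * Complex.exp (ι x) := by
  simp [expEval, AddMonoidAlgebra.lift_apply]

/-- The action of an automorphism of `K` on the group ring of `K`. -/
noncomputable def galoisAct (σ : K ≃ₐ[ℚ] K) : AddMonoidAlgebra ℤ K ≃ₐ[ℤ] AddMonoidAlgebra ℤ K :=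
  AddMonoidAlgebra.domCongr ℤ ℤ (σ : K ≃+ K)

theorem galoisAct_single (σ : K ≃ₐ[ℚ] K) (x : K) (m : ℤ) :
    galoisAct σ (AddMonoidAlgebra.single x m) = AddMonoidAlgebra.single (σ x) m := by
  simp [galoisAct]
  rfl

theorem galoisAct_mul_apply (σ τ : K ≃ₐ[ℚ] K) (y : AddMonoidAlgebra ℤ K) :
    galoisAct σ (galoisAct τ y) = galoisAct (σ * τ) y := by
  ext x
  simp [galoisAct]
  rfl

theorem coeff_apply_of_galoisAct_eq {y : AddMonoidAlgebra ℤ K}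
    (h : ∀ σ : K ≃ₐ[ℚ] K, galoisAct σ y = y) (σ : K ≃ₐ[ℚ] K) (x : K) :
    y.coeff (σ x) = y.coeff x := by
  conv_lhs => rw [← h σ]
  simp [galoisAct]

end GroupRing

section Galois

variable {K : Type*} [Field K] [Algebra ℚ K] [FiniteDimensional ℚ K] [IsGalois ℚ K]

theorem exists_intCast_eq_of_isIntegral_of_forall_algEquiv_apply_eq {x : K} (hx : IsIntegral ℤ x)
    (h : ∀ σ : K ≃ₐ[ℚ] K, σ x = x) : ∃ z : ℤ, (z : K) = x := by
  obtain ⟨q, rfl⟩ := (IsGalois.mem_range_algebraMap_iff_fixed x).mpr h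
  rw [isIntegral_algebraMap_iff (algebraMap ℚ K).injective] at hx
  obtain ⟨z, rfl⟩ := IsIntegrallyClosed.isIntegral_iff.mp hx
  exact ⟨z, by simp⟩

/-- A nontrivial Galois-invariant integral relation between exponentials of algebraic numbers
does not exist, as long as the coefficient of `exp 0` is nonzero. -/
theorem sum_mul_exp_ne_zero_of_invariant_of_apply_zero_ne_zero (ι : K →ₐ[ℚ] ℂ) (c : K →₀ ℤ)
    (hinv : ∀ (σ : K ≃ₐ[ℚ] K) (x : K), c (σ x) = c x) (h0 : c 0 ≠ 0) :
    c.sum (fun x m => (m : ℂ) * Complex.exp (ι x)) ≠ 0 := by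
  classical
  intro hsum
  have : CharZero K := algebraRat.charZero K
  have hAlg : ∀ x : K, IsAlgebraic ℤ x := fun x =>
    (IsFractionRing.isAlgebraic_iff ℤ ℚ K).mpr (Algebra.IsAlgebraic.isAlgebraic x)
  set s := c.support.erase 0 with hs
  obtain ⟨f, hf0, hfs⟩ := exists_intPolynomial_eval_zero_ne_zero_and_aeval_eq_zero s
    (Finset.notMem_erase 0 _) fun x _ => hAlg x
  have hf : f ≠ 0 := fun h => hf0 (by simp [h])
  have : Algebra.IsAlgebraic ℤ K := ⟨hAlg⟩
  obtain ⟨a, ha0, ha⟩ := exists_integral_multiples ℤ ℚ s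
  obtain ⟨b, hb⟩ := LindemannWeierstrass.exp_polynomial_approx f hf0
  set d := f.natDegree
  obtain ⟨p, hpk, hp, hlt⟩ := exists_prime_gt_mul_pow_div_factorial_lt_one
    (∑ x ∈ s, |(c x : ℝ)|) (|(a : ℝ)| ^ d * b)
    (max (f.eval 0).natAbs (max a.natAbs (c 0).natAbs))
  simp only [gt_iff_lt, max_lt_iff] at hpk
  obtain ⟨n, hpn, g, hg, happ⟩ := hb p hpk.1 hp
  set M := p * d
  have hint : IsIntegral ℤ (∑ x ∈ s, c x • a ^ M • Polynomial.aeval x g) :=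
    IsIntegral.sum _ fun x hx =>
      (isIntegral_pow_smul_aeval (ha x hx) g (hg.trans (Nat.sub_le _ _))).smul _
  obtain ⟨z, hz⟩ := exists_intCast_eq_of_isIntegral_of_forall_algEquiv_apply_eq hint fun σ => by
    rw [map_sum]
    refine Finset.sum_bij (fun x _ => σ x) ?_ (fun _ _ _ _ h => σ.injective h) ?_ ?_
    · intro x hx
      simpa [hs, hinv] using hx
    · intro x hx
      refine ⟨σ.symm x, ?_, by simp⟩
      simpa [hs, hinv] using hx
    · intro x _
      rw [hinv, map_zsmul, map_zsmul]
      congr 2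
      exact (Polynomial.aeval_algHom_apply (σ.toAlgHom.restrictScalars ℤ) x g).symm
  have hzC : (z : ℂ) = ∑ x ∈ s, (c x : ℂ) * ((a : ℂ) ^ M * Polynomial.aeval (ι x) g) := by
    have := congrArg ι hz
    rw [map_intCast, map_sum] at this
    rw [this]
    refine Finset.sum_congr rfl fun x _ => ?_
    rw [map_zsmul, map_zsmul, zsmul_eq_mul, zsmul_eq_mul, Int.cast_pow]
    congr 2
    exact (Polynomial.aeval_algHom_apply (ι.restrictScalars ℤ) x g).symm
  have hsum' : (c 0 : ℂ) + ∑ x ∈ s, (c x : ℂ) * Complex.exp (ι x) = 0 := by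
    rw [← hsum, Finsupp.sum, ← Finset.add_sum_erase _ _ (Finsupp.mem_support_iff.mpr h0)]
    simp [hs]
  have hdvd : ¬ (p : ℤ) ∣ a ^ M * n * c 0 + p * z := by
    have hp' : Prime (p : ℤ) := Nat.prime_iff_prime_int.mp hp
    have key : ∀ m : ℤ, m ≠ 0 → m.natAbs < p → ¬ (p : ℤ) ∣ m := fun m hm hlt hd =>
      absurd (Nat.le_of_dvd (Int.natAbs_pos.mpr hm) (Int.natCast_dvd.mp hd)) (by omega)
    rw [dvd_add_left (dvd_mul_right _ _)]
    intro h
    rcases hp'.dvd_or_dvd h with h | h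
    · rcases hp'.dvd_or_dvd h with h | h
      · exact key a ha0 hpk.2.1 (hp'.dvd_of_dvd_pow h)
      · exact hpn h
    · exact key _ h0 hpk.2.2 h
  have hone : (1 : ℝ) ≤ ‖((a ^ M * n * c 0 + p * z : ℤ) : ℂ)‖ := by
    rw [Complex.norm_intCast]
    exact_mod_cast Int.one_le_abs fun h => hdvd (by rw [h]; exact dvd_zero _)
  have heq : ((a ^ M * n * c 0 + p * z : ℤ) : ℂ) = -∑ x ∈ s,
      (c x : ℂ) * ((a : ℂ) ^ M * (n • Complex.exp (ι x) - p • Polynomial.aeval (ι x) g)) := by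
    have h1 : (c 0 : ℂ) = -∑ x ∈ s, (c x : ℂ) * Complex.exp (ι x) := by
      linear_combination hsum'
    push_cast
    rw [hzC, h1, mul_neg, Finset.mul_sum, Finset.mul_sum, ← Finset.sum_neg_distrib,
      ← Finset.sum_add_distrib, ← Finset.sum_neg_distrib]
    refine Finset.sum_congr rfl fun x _ => ?_
    simp only [zsmul_eq_mul, nsmul_eq_mul]
    ring
  rw [heq, norm_neg] at hone
  rw [Finset.sum_mul] at hlt
  refine absurd (hone.trans ((norm_sum_le _ _).trans (Finset.sum_le_sum fun x hx => ?_))) hlt.not_ge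
  have hroot : ι x ∈ f.aroots ℂ := by
    rw [Polynomial.mem_aroots]
    refine ⟨hf, ?_⟩
    have h := Polynomial.aeval_algHom_apply (ι.restrictScalars ℤ) x f
    rw [hfs x hx, map_zero] at h
    exact h
  rw [norm_mul, norm_mul, Complex.norm_intCast, norm_pow, Complex.norm_intCast, mul_pow, ← pow_mul,
    mul_comm d p, mul_div_assoc]
  gcongr
  exact happ hroot

theorem expEval_ne_zero_of_galoisAct_eq (ι : K →ₐ[ℚ] ℂ) {y : AddMonoidAlgebra ℤ K} (hy : y ≠ 0)
    (h : ∀ σ : K ≃ₐ[ℚ] K, galoisAct σ y = y) : expEval ι y ≠ 0 := by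
  intro hev
  obtain ⟨x, hx⟩ : ∃ x, y.coeff x ≠ 0 := by
    by_contra! hc
    exact hy (by ext x; simpa using hc x)
  set t : AddMonoidAlgebra ℤ K := ∑ τ : K ≃ₐ[ℚ] K, AddMonoidAlgebra.single (τ (-x)) 1 with ht
  have htinv : ∀ σ : K ≃ₐ[ℚ] K, galoisAct σ t = t := fun σ => by
    rw [ht, map_sum]
    exact Fintype.sum_equiv (Equiv.mulLeft σ) _ _ fun τ => by simp [galoisAct_single]
  have hinv : ∀ σ : K ≃ₐ[ℚ] K, galoisAct σ (y * t) = y * t := fun σ => by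
    rw [map_mul, h, htinv]
  refine sum_mul_exp_ne_zero_of_invariant_of_apply_zero_ne_zero ι (y * t).coeff
    (coeff_apply_of_galoisAct_eq hinv) ?_ ?_
  · have hcoeff : ∀ τ : K ≃ₐ[ℚ] K,
        (y * AddMonoidAlgebra.single (τ (-x)) 1).coeff 0 = y.coeff x := fun τ => by
      rw [AddMonoidAlgebra.coeff_mul_single_apply, ← coeff_apply_of_galoisAct_eq h τ x]
      simp
    rw [ht, Finset.mul_sum, AddMonoidAlgebra.coeff_sum, Finsupp.finsetSum_apply,
      Finset.sum_congr rfl fun τ _ => hcoeff τ]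
    simp [hx]
  · rw [← expEval_apply, map_mul, hev, zero_mul]

theorem expEval_ne_zero (ι : K →ₐ[ℚ] ℂ) {y : AddMonoidAlgebra ℤ K} (hy : y ≠ 0) :
    expEval ι y ≠ 0 := by
  have hprod : ∏ σ : K ≃ₐ[ℚ] K, galoisAct σ y ≠ 0 :=
    Finset.prod_ne_zero_iff.mpr fun σ _ => (map_ne_zero_iff _ (galoisAct σ).injective).mpr hy
  have hne := expEval_ne_zero_of_galoisAct_eq ι hprod fun σ => by
    rw [map_prod]
    exact Fintype.prod_equiv (Equiv.mulLeft σ) _ _ fun τ => by simp [galoisAct_mul_apply]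
  rw [map_prod] at hne
  have h1 : galoisAct (1 : K ≃ₐ[ℚ] K) y = y := by
    ext x
    simp [galoisAct]
    rfl
  simpa [h1] using Finset.prod_ne_zero_iff.mp hne 1 (Finset.mem_univ _)

theorem transcendental_exp_algHom_apply (ι : K →ₐ[ℚ] ℂ) {x : K} (hx : x ≠ 0) :
    Transcendental ℤ (Complex.exp (ι x)) := by
  classical
  rw [transcendental_iff]
  intro q hq
  have : CharZero K := algebraRat.charZero K
  by_contra hq0
  let y : AddMonoidAlgebra ℤ K := Polynomial.aeval (AddMonoidAlgebra.single x 1) q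
  have hy : y = ∑ i ∈ q.support, AddMonoidAlgebra.single (i • x) (q.coeff i) := by
    simp only [y, Polynomial.aeval_def, Polynomial.eval₂_eq_sum, Polynomial.sum_def,
      AddMonoidAlgebra.single_pow, ← Algebra.smul_def, AddMonoidAlgebra.smul_single, one_pow,
      smul_eq_mul, mul_one]
  refine expEval_ne_zero ι (y := y) (fun h => hq0 ?_) ?_
  · ext i
    have hi : y.coeff (i • x) = 0 := by simp [h]
    rw [hy, AddMonoidAlgebra.coeff_sum, Finsupp.finsetSum_apply] at hi
    have hinj : ∀ j : ℕ, j • x = i • x ↔ j = i := fun j => by simp [hx]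
    simpa [Finsupp.single_apply, hinj, -nsmul_eq_mul] using hi
  · rw [← Polynomial.aeval_algHom_apply, expEval_single]
    simpa using hq

end Galois

/-- The **Hermite–Lindemann theorem**. -/
theorem Complex.transcendental_exp_of_isAlgebraic {x : ℂ} (hx0 : x ≠ 0) (hx : IsAlgebraic ℚ x) :
    Transcendental ℚ (Complex.exp x) := by
  let K : IntermediateField ℚ ℂ := IntermediateField.adjoin ℚ ((minpoly ℚ x).rootSet ℂ)
  have : (minpoly ℚ x).IsSplittingField ℚ K :=
    IntermediateField.adjoin_rootSet_isSplittingField (IsAlgClosed.splits _)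
  have : FiniteDimensional ℚ K := Polynomial.IsSplittingField.finiteDimensional K (minpoly ℚ x)
  have : IsGalois ℚ K :=
    IsGalois.of_separable_splitting_field (minpoly.irreducible hx.isIntegral).separable
  have hxK : x ∈ K := IntermediateField.subset_adjoin _ _
    ((Polynomial.mem_rootSet_of_ne (minpoly.ne_zero hx.isIntegral)).mpr (minpoly.aeval ℚ x))
  have h := transcendental_exp_algHom_apply (algebraMap K ℂ).toRatAlgHom (x := ⟨x, hxK⟩)
    fun h => hx0 (congrArg Subtype.val h)
  exact fun halg => h ((IsFractionRing.isAlgebraic_iff ℤ ℚ ℂ).mpr halg)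

theorem isAlgebraic_exp_of_mem_closure_log_image {S : Set ℂ} (h0 : ∀ α ∈ S, α ≠ 0)
    (halg : ∀ α ∈ S, IsAlgebraic ℚ α) {g : ℂ} (hg : g ∈ AddSubgroup.closure (Complex.log '' S)) :
    IsAlgebraic ℚ (Complex.exp g) := by
  induction hg using AddSubgroup.closure_induction with
  | mem x hx =>
    obtain ⟨α, hα, rfl⟩ := hx
    rw [Complex.exp_log (h0 α hα)]
    exact halg α hα
  | zero => simpa using isAlgebraic_one
  | add x y _ _ hx hy => rw [Complex.exp_add]; exact hx.mul hy
  | neg x _ hx => rw [Complex.exp_neg]; exact hx.inv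

theorem stmt7 (S : Set ℂ) (h0 : ∀ α ∈ S, α ≠ 0) (halg : ∀ α ∈ S, IsAlgebraic ℚ α) :
    ∀ g ∈ AddSubgroup.closure (Complex.log '' S), g ≠ 0 → Transcendental ℚ g := by
  intro g hg hg0 hgalg
  exact Complex.transcendental_exp_of_isAlgebraic hg0 hgalg
    (isAlgebraic_exp_of_mem_closure_log_image h0 halg hg)
end

section
/- For every cardinal number ℵ with ℵ₀ ≤ ℵ ≤ 𝔠, the set of additive subgroups G of ℂ such that every nonzero element of G is transcendental over ℚ and the cardinality of G equals ℵ has cardinality at least 2^ℵ. -/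
open Cardinal

theorem AlgebraicIndependent.transcendental_linearCombination {ι R A : Type*} [CommRing R]
    [IsDomain R] [CommRing A] [IsDomain A] [Algebra R A] {x : ι → A}
    (hx : AlgebraicIndependent R x) {f : ι →₀ R} (hf : f ≠ 0) :
    Transcendental R (Finsupp.linearCombination R x f) := by
  classical
  have := (faithfulSMul_iff_algebraMap_injective R A).mpr hx.algebraMap_injective
  obtain ⟨i, hi⟩ := Finsupp.ne_iff.mp hf
  rw [Finsupp.zero_apply] at hi
  intro halg
  set S := Algebra.adjoin R (x '' {i}ᶜ)
  refine hx.transcendental_adjoin (s := {i}ᶜ) (i := i) (by simp) ?_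
  have hrest : Finsupp.linearCombination R x (f.erase i) ∈ S := by
    rw [Finsupp.linearCombination_apply]
    refine sum_mem fun j hj ↦ S.smul_mem (Algebra.subset_adjoin ⟨j, ?_, rfl⟩) _
    rw [Finsupp.support_erase] at hj
    exact Finset.ne_of_mem_erase hj
  have hsplit : f i • x i = Finsupp.linearCombination R x f -
      Finsupp.linearCombination R x (f.erase i) := by
    conv_rhs => enter [1]; rw [← Finsupp.single_add_erase i f]
    rw [map_add, Finsupp.linearCombination_single, add_sub_cancel_right]
  have hS : IsAlgebraic S (f i • x i) := by
    rw [hsplit]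
    exact (halg.extendScalars (S := S) (FaithfulSMul.algebraMap_injective R S)).sub
      (isAlgebraic_algebraMap (⟨_, hrest⟩ : S))
  have hne : algebraMap R S (f i) ∈ nonZeroDivisors S :=
    mem_nonZeroDivisors_of_ne_zero
      ((map_ne_zero_iff _ (FaithfulSMul.algebraMap_injective R S)).mpr hi)
  rw [← algebraMap_smul S] at hS
  exact IsAlgebraic.of_smul hne hS

/-- The finitely supported integer-valued functions that are even off `s`. -/
def evenOff {ι : Type*} (s : Set ι) : AddSubgroup (ι →₀ ℤ) where
  carrier := {f | ∀ i ∉ s, Even (f i)}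
  zero_mem' := by simp
  add_mem' hf hg i hi := (hf i hi).add (hg i hi)
  neg_mem' hf i hi := (hf i hi).neg

theorem mem_evenOff {ι : Type*} {s : Set ι} {f : ι →₀ ℤ} :
    f ∈ evenOff s ↔ ∀ i ∉ s, Even (f i) :=
  Iff.rfl

theorem single_one_mem_evenOff {ι : Type*} {s : Set ι} {i : ι} :
    Finsupp.single i 1 ∈ evenOff s ↔ i ∈ s := by
  classical
  rw [mem_evenOff]
  refine ⟨fun h ↦ by_contra fun hi ↦ by simpa using h i hi, fun hi j hj ↦ ?_⟩
  have hij : j ≠ i := fun h ↦ hj (h.symm ▸ hi)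
  rw [Finsupp.single_eq_of_ne hij]
  exact Even.zero

theorem evenOff_injective {ι : Type*} :
    Function.Injective (evenOff : Set ι → AddSubgroup (ι →₀ ℤ)) := fun s t h ↦ by
  ext i
  rw [← single_one_mem_evenOff, h, single_one_mem_evenOff]

theorem mk_evenOff {ι : Type*} [Infinite ι] (s : Set ι) : #(evenOff s) = #ι := by
  apply le_antisymm
  · refine (mk_subtype_le _).trans ?_
    simp
  · refine mk_le_of_injective (f := fun i ↦ ⟨Finsupp.single i 2, fun j _ ↦ ?_⟩) fun i j h ↦ ?_
    · classical
      rw [Finsupp.single_apply]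
      split_ifs <;> decide
    · exact Finsupp.single_left_injective two_ne_zero (congrArg Subtype.val h)

theorem exists_algebraicIndependent_complex {ι : Type} (h : #ι ≤ continuum) :
    ∃ x : ι → ℂ, AlgebraicIndependent ℤ x := by
  obtain ⟨κ, y, hy⟩ := exists_isTranscendenceBasis' ℤ ℂ
  have hκ : #ℂ = #κ := IsAlgClosed.cardinal_eq_cardinal_transcendence_basis_of_aleph0_lt' y hy
    mk_le_aleph0 (by rw [mk_complex]; exact aleph0_lt_continuum)
  rw [← mk_complex, hκ] at h
  obtain ⟨e⟩ := h
  exact ⟨y ∘ e, hy.1.comp e e.injective⟩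

theorem stmt8 (ℵ : Cardinal) (h1 : Cardinal.aleph0 ≤ ℵ) (h2 : ℵ ≤ Cardinal.continuum) :
    2 ^ ℵ ≤ #{G : AddSubgroup ℂ | (∀ g ∈ G, g ≠ 0 → Transcendental ℚ g) ∧ #↥G = ℵ} := by
  induction ℵ using Cardinal.inductionOn with | _ ι
  have : Infinite ι := infinite_iff.mpr h1
  obtain ⟨x, hx⟩ := exists_algebraicIndependent_complex h2
  let φ : (ι →₀ ℤ) →+ ℂ := (Finsupp.linearCombination ℤ x).toAddMonoidHom
  have hφ : Function.Injective φ := hx.linearIndependent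
  rw [← mk_set]
  refine mk_le_of_injective (f := fun s ↦ ⟨(evenOff s).map φ, ?_, ?_⟩) fun s t h ↦ ?_
  · rintro _ ⟨f, -, rfl⟩ hf
    have hf0 : f ≠ 0 := by
      rintro rfl
      exact hf (map_zero φ)
    exact fun h ↦ hx.transcendental_linearCombination hf0
      ((IsFractionRing.isAlgebraic_iff ℤ ℚ ℂ).mpr h)
  · rw [← mk_congr ((evenOff s).equivMapOfInjective φ hφ).toEquiv, mk_evenOff]
  · exact evenOff_injective (AddSubgroup.map_injective hφ (congrArg Subtype.val h))
end

section
/- For every cardinal number ℵ with ℵ₀ ≤ ℵ ≤ 𝔠, the set of additive subgroups G of ℝ such that every nonzero element of G is transcendental over ℚ and the cardinality of G equals ℵ has cardinality at least 2^ℵ. -/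
open Cardinal

theorem LinearIndependent.mk_span_rat {ι V : Type} [Infinite ι] [AddCommGroup V] [Module ℚ V]
    {v : ι → V} (hv : LinearIndependent ℚ v) : #(Submodule.span ℚ (Set.range v)) = #ι := by
  rw [(Module.Basis.span hv).repr.toEquiv.cardinal_eq, mk_finsupp_of_infinite, Cardinal.mkRat]
  exact max_eq_left (aleph0_le_mk ι)

theorem exists_linearIndependent_transcendental_span :
    ∃ (ι : Type) (v : ι → ℝ), #ι = continuum ∧ LinearIndependent ℚ v ∧
      ∀ x ∈ Submodule.span ℚ (Set.range v), x ≠ 0 → Transcendental ℚ x := by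
  let A : Submodule ℚ ℝ := Subalgebra.toSubmodule (integralClosure ℚ ℝ)
  have mem_A (x : ℝ) : x ∈ A ↔ IsAlgebraic ℚ x := isAlgebraic_iff_isIntegral.symm
  obtain ⟨W, hW⟩ := A.exists_isCompl
  have card_A : #A = ℵ₀ := by
    rw [← Algebraic.cardinalMk_of_countable_of_charZero ℚ ℝ]
    exact Cardinal.mk_congr (Equiv.subtypeEquivRight mem_A)
  have card_mul : #A * #W = continuum := by
    rw [← mk_real, ← (A.prodEquivOfIsCompl W hW).toEquiv.cardinal_eq, mk_prod, lift_id, lift_id]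
  have card_W : #W = continuum := by
    rw [card_A] at card_mul
    have hW0 : #W ≠ 0 := mk_ne_zero W
    rw [mul_eq_max' (by rw [card_mul]; exact aleph0_le_continuum)] at card_mul
    rcases max_choice ℵ₀ #W with h | h
    · exact absurd (h.symm.trans card_mul) aleph0_lt_continuum.ne
    · exact h.symm.trans card_mul
  let b := Module.Free.chooseBasis ℚ W
  refine ⟨_, W.subtype ∘ b, ?_, b.linearIndependent.map' _ W.ker_subtype, fun x hx hx0 hxA ↦ ?_⟩
  · rw [← Module.Free.rank_eq_card_chooseBasisIndex, ← card_W]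
    apply Module.Free.rank_eq_mk_of_infinite_lt
    rw [lift_id, lift_id, card_W, Cardinal.mkRat]
    exact aleph0_lt_continuum
  · have hxW : x ∈ W := by
      refine Submodule.span_le.2 ?_ hx
      rintro _ ⟨i, rfl⟩
      exact (b i).2
    exact hx0 (Submodule.disjoint_def.1 hW.disjoint x ((mem_A x).2 hxA) hxW)

theorem stmt9 (ℵ : Cardinal) (h1 : Cardinal.aleph0 ≤ ℵ) (h2 : ℵ ≤ Cardinal.continuum) :
    2 ^ ℵ ≤ #{G : AddSubgroup ℝ | (∀ g ∈ G, g ≠ 0 → Transcendental ℚ g) ∧ #↥G = ℵ} := by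
  obtain ⟨ι, v, hι, hv, htr⟩ := exists_linearIndependent_transcendental_span
  induction ℵ using Cardinal.inductionOn with | _ K
  have : Infinite K := infinite_iff.2 h1
  have card_sum : #(K ⊕ K) = #K := by rw [← add_def, add_eq_self h1]
  obtain ⟨e⟩ : #(K ⊕ K) ≤ #ι := by rw [card_sum, hι]; exact h2
  let w : K ⊕ K → ℝ := v ∘ e
  have hw : LinearIndependent ℚ w := hv.comp e e.injective
  let S (T : Set K) : Set (K ⊕ K) := Set.range Sum.inl ∪ Sum.inr '' T
  let G (T : Set K) : Submodule ℚ ℝ := Submodule.span ℚ (w '' S T)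
  have mem_G (T : Set K) (k : K) : w (Sum.inr k) ∈ G T ↔ k ∈ T := by
    refine ⟨fun h ↦ ?_, fun h ↦ Submodule.subset_span ⟨_, Or.inr ⟨k, h, rfl⟩, rfl⟩⟩
    by_contra hk
    exact hw.notMem_span_image (by simpa [S] using hk) h
  have card_S (T : Set K) : #(S T) = #K := by
    refine ((mk_set_le _).trans card_sum.le).antisymm ?_
    rw [← mk_range_eq (Sum.inl : K → K ⊕ K) Sum.inl_injective]
    exact mk_le_mk_of_subset Set.subset_union_left
  have card_G (T : Set K) : #(G T) = #K := by
    have : Infinite (S T) := infinite_iff.2 (by rw [card_S]; exact h1)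
    have h := (hw.comp ((↑) : S T → K ⊕ K) Subtype.val_injective).mk_span_rat
    rwa [Set.range_comp, Subtype.range_coe, card_S] at h
  rw [← mk_set]
  refine mk_le_of_injective (f := fun T ↦ ⟨(G T).toAddSubgroup, fun g hg ↦ htr g ?_, card_G T⟩) ?_
  · refine Submodule.span_mono ?_ hg
    rintro _ ⟨i, -, rfl⟩
    exact ⟨e i, rfl⟩
  · intro T U h
    have hG : G T = G U := Submodule.toAddSubgroup_injective (congrArg Subtype.val h)
    ext k
    rw [← mem_G, hG, mem_G]
end

section
/- The set of additive subgroups G of ℂ such that every nonzero element of G is transcendental over ℚ, G is countably infinite, G with its subspace topology is homeomorphic to ℚ (with its usual topology), and G is isomorphic as an abstract additive group to the direct sum of countably infinitely many copies of ℚ (equivalently, to a ℚ-vector space of countably infinite dimension), has cardinality 𝔠. -/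
open Cardinal

/-- A countable dense set of reals is homeomorphic to the rationals. -/
theorem nonempty_homeomorph_rat_of_countable_of_dense {S : Set ℝ} (hc : S.Countable)
    (hd : Dense S) : Nonempty (S ≃ₜ ℚ) := by
  have hc' : Countable S := hc.to_subtype
  have hbtw : ∀ {x y : ℝ}, x < y → ∃ a : S, (a : ℝ) ∈ Set.Ioo x y := fun h => by
    obtain ⟨a, ha, hxy⟩ := hd.exists_between h
    exact ⟨⟨a, ha⟩, hxy⟩
  have hne : Nonempty S := ⟨(hbtw zero_lt_one).choose⟩
  have hdense : DenselyOrdered S := ⟨fun x y h => by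
    obtain ⟨a, ha⟩ := hbtw (show (x : ℝ) < y from h)
    exact ⟨a, ha.1, ha.2⟩⟩
  have hmax : NoMaxOrder S := ⟨fun x => by
    obtain ⟨a, ha⟩ := hbtw (lt_add_one (x : ℝ))
    exact ⟨a, ha.1⟩⟩
  have hmin : NoMinOrder S := ⟨fun x => by
    obtain ⟨a, ha⟩ := hbtw (sub_one_lt (x : ℝ))
    exact ⟨a, ha.2⟩⟩
  have hord : OrderTopology S := induced_orderTopology (Subtype.val : S → ℝ) Iff.rfl hbtw
  obtain ⟨e⟩ := Order.iso_of_countable_dense S ℚ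
  exact ⟨e.toHomeomorph⟩

/-- A nonzero rational subspace of the real line is dense. -/
theorem Submodule.dense_of_ne_zero_mem {W : Submodule ℚ ℝ} {x : ℝ} (hx : x ∈ W) (h0 : x ≠ 0) :
    Dense (W : Set ℝ) := by
  have h : Dense (Homeomorph.mulRight₀ x h0 '' Set.range ((↑) : ℚ → ℝ)) :=
    (Homeomorph.mulRight₀ x h0).surjective.denseRange.dense_image
      (Homeomorph.mulRight₀ x h0).continuous (Rat.denseRange_cast (𝕜 := ℝ))
  refine h.mono ?_
  rintro _ ⟨_, ⟨q, rfl⟩, rfl⟩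
  simpa [Rat.smul_def] using W.smul_mem q hx

/-- The quotient of the reals by the real algebraic numbers has dimension `𝔠` over `ℚ`. -/
theorem rank_real_quotient_algebraic :
    Module.rank ℚ (ℝ ⧸ (Subalgebra.algebraicClosure ℚ ℝ).toSubmodule) = continuum := by
  have hA : Module.rank ℚ (Subalgebra.algebraicClosure ℚ ℝ).toSubmodule ≤ ℵ₀ :=
    (rank_le_card ℚ _).trans (le_aleph0_iff_set_countable.2 (Algebraic.countable ℚ ℝ))
  have h := (Subalgebra.algebraicClosure ℚ ℝ).toSubmodule.rank_quotient_add_rank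
  rw [Real.rank_rat_real] at h
  refine le_antisymm (h ▸ self_le_add_right _ _) (not_lt.1 fun hlt => ?_)
  exact absurd h (add_lt_of_lt aleph0_le_continuum hlt (hA.trans_lt aleph0_lt_continuum)).ne

/-- There is a rational vector space of real transcendental numbers with a basis indexed by
`ℝ × ℕ`. -/
theorem exists_transcendental_linearMap :
    ∃ f : (ℝ × ℕ →₀ ℚ) →ₗ[ℚ] ℝ, ∀ v, v ≠ 0 → Transcendental ℚ (f v) := by
  obtain ⟨s, hs⟩ :=
    (Subalgebra.algebraicClosure ℚ ℝ).toSubmodule.mkQ.exists_rightInverse_of_surjective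
      (Submodule.range_mkQ _)
  have hrank : Module.rank ℚ (ℝ × ℕ →₀ ℚ) =
      Module.rank ℚ (ℝ ⧸ (Subalgebra.algebraicClosure ℚ ℝ).toSubmodule) := by
    rw [rank_real_quotient_algebraic]
    simp [mk_real]
  obtain ⟨e⟩ := nonempty_linearEquiv_of_rank_eq hrank
  refine ⟨s ∘ₗ e.toLinearMap, fun v hv halg => hv ?_⟩
  have h : (Subalgebra.algebraicClosure ℚ ℝ).toSubmodule.mkQ (s (e v)) = e v :=
    LinearMap.congr_fun hs (e v)
  have h0 : (Subalgebra.algebraicClosure ℚ ℝ).toSubmodule.mkQ (s (e v)) = 0 := by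
    rw [Submodule.mkQ_apply, Submodule.Quotient.mk_eq_zero]
    exact halg
  simpa using h.symm.trans h0

/-- A family of countable sets in a type of size at most `𝔠` has at most `𝔠` members. -/
theorem Cardinal.mk_countable_sets_le_continuum {α : Type*} (hα : #α ≤ continuum) :
    #{t : Set α // #t ≤ ℵ₀} ≤ continuum := by
  refine (mk_bounded_set_le α ℵ₀).trans ?_
  rw [← continuum_power_aleph0]
  exact power_le_power_right (max_le hα aleph0_le_continuum)

/-- An injective linear map from `ℕ →₀ ℚ` to the reals has image in `ℂ` homeomorphic to `ℚ`. -/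
theorem nonempty_range_ofReal_homeomorph_rat {f : (ℕ →₀ ℚ) →ₗ[ℚ] ℝ}
    (hf : Function.Injective f) :
    Nonempty ((Complex.ofRealHom.toAddMonoidHom.comp f.toAddMonoidHom).range ≃ₜ ℚ) := by
  have hd : Dense (Set.range f) := by
    rw [← LinearMap.coe_range]
    refine Submodule.dense_of_ne_zero_mem
      (LinearMap.mem_range_self f (Finsupp.single 0 1)) ?_
    rw [ne_eq, map_eq_zero_iff f hf]
    simp
  obtain ⟨e⟩ := nonempty_homeomorph_rat_of_countable_of_dense (Set.countable_range f) hd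
  have himage : Complex.ofReal '' Set.range f =
      ((Complex.ofRealHom.toAddMonoidHom.comp f.toAddMonoidHom).range : Set ℂ) := by
    rw [← Set.range_comp]
    rfl
  exact ⟨((Complex.isometry_ofReal.isEmbedding.homeomorphImage (Set.range f)).trans
    (Homeomorph.setCongr himage)).symm.trans e⟩

theorem stmt10 :
    #{G : AddSubgroup ℂ | (∀ g ∈ G, g ≠ 0 → Transcendental ℚ g) ∧
        Countable ↥G ∧ Infinite ↥G ∧
        Nonempty (↥G ≃ₜ ℚ) ∧
        Nonempty (↥G ≃+ (ℕ →₀ ℚ))} = Cardinal.continuum := by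
  apply le_antisymm
  · refine le_trans ?_ (mk_countable_sets_le_continuum (α := ℂ) mk_complex.le)
    refine mk_le_of_injective (f := fun G => ⟨(G.1 : Set ℂ), ?_⟩) ?_
    · exact mk_le_aleph0_iff.2 G.2.2.1
    · intro G H h
      exact Subtype.ext (SetLike.coe_injective (congrArg Subtype.val h))
  · obtain ⟨f, hf⟩ := exists_transcendental_linearMap
    have hinj : Function.Injective f := by
      refine (injective_iff_map_eq_zero f).2 fun v hv => by_contra fun h => hf v h ?_
      rw [hv]
      exact isAlgebraic_zero
    let j (r : ℝ) : (ℕ →₀ ℚ) →ₗ[ℚ] (ℝ × ℕ →₀ ℚ) := Finsupp.lmapDomain ℚ ℚ (Prod.mk r)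
    have hj (r : ℝ) : Function.Injective (j r) :=
      Finsupp.mapDomain_injective (Prod.mk_right_injective r)
    have hfj (r : ℝ) : Function.Injective (f ∘ₗ j r) := hinj.comp (hj r)
    let φ (r : ℝ) : (ℕ →₀ ℚ) →+ ℂ :=
      Complex.ofRealHom.toAddMonoidHom.comp (f ∘ₗ j r).toAddMonoidHom
    have hφ (r : ℝ) : Function.Injective (φ r) := Complex.ofReal_injective.comp (hfj r)
    have e (r : ℝ) : (φ r).range ≃+ (ℕ →₀ ℚ) := (AddMonoidHom.ofInjective (hφ r)).symm
    rw [← mk_real]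
    refine mk_le_of_injective (f := fun r => ⟨(φ r).range, ?_, ?_, ?_, ?_, ⟨e r⟩⟩) ?_
    · rintro _ ⟨v, rfl⟩ hv
      have hv0 : j r v ≠ 0 := fun h => hv (by
        change ((f (j r v) : ℝ) : ℂ) = 0
        rw [h, map_zero, Complex.ofReal_zero])
      exact (transcendental_algebraMap_iff (R := ℚ) (S := ℝ) (A := ℂ)
        Complex.ofReal_injective).2 (hf _ hv0)
    · exact (e r).injective.countable
    · exact Infinite.of_injective _ (e r).symm.injective
    · exact nonempty_range_ofReal_homeomorph_rat (hfj r)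
    · intro r t h
      have hrange : (φ r).range = (φ t).range := congrArg Subtype.val h
      obtain ⟨v, hv⟩ : φ r (Finsupp.single 0 1) ∈ (φ t).range :=
        hrange ▸ ⟨Finsupp.single 0 1, rfl⟩
      have hjv : j t v = j r (Finsupp.single 0 1) := hinj (Complex.ofReal_injective hv)
      by_contra hrt
      have h1 : j r (Finsupp.single 0 1) (r, 0) = 1 := by
        simp [j, Finsupp.mapDomain_single]
      rw [← hjv] at h1
      have h0 : j t v (r, 0) = 0 := by
        refine Finsupp.mapDomain_of_notMem_range v (r, 0) ?_
        rintro ⟨n, hn⟩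
        exact hrt (congrArg Prod.fst hn).symm
      exact zero_ne_one (h0.symm.trans h1)
end

section
/- The set of additive subgroups G of ℂ such that every nonzero element of G is transcendental over ℚ and such that G, with its subspace topology, is isomorphic as a topological group to the discrete additive group ℤ × ℤ, has cardinality 𝔠. -/
open Cardinal

/-- The additive homomorphism sending `(m, n)` to `t * (m + n * I)`. -/
noncomputable def scaledGaussian (t : ℝ) : ℤ × ℤ →+ ℂ where
  toFun p := (t : ℂ) * ((p.1 : ℂ) + p.2 * Complex.I)
  map_zero' := by simp
  map_add' p q := by
    simp only [Prod.fst_add, Prod.snd_add, Int.cast_add]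
    ring

lemma scaledGaussian_apply (t : ℝ) (p : ℤ × ℤ) :
    scaledGaussian t p = (t : ℂ) * ((p.1 : ℂ) + p.2 * Complex.I) := rfl

lemma isEmbedding_scaledGaussian {t : ℝ} (ht : t ≠ 0) :
    Topology.IsEmbedding (scaledGaussian t) := by
  have h₁ : Topology.IsEmbedding (Prod.map ((↑) : ℤ → ℝ) ((↑) : ℤ → ℝ)) :=
    Int.isClosedEmbedding_coe_real.isEmbedding.prodMap Int.isClosedEmbedding_coe_real.isEmbedding
  have h₂ := Complex.equivRealProdCLM.symm.toHomeomorph.isEmbedding.comp h₁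
  have h₃ := (Homeomorph.mulLeft₀ (t : ℂ) (by exact_mod_cast ht)).isEmbedding.comp h₂
  convert h₃ using 1
  ext p
  simp [scaledGaussian_apply, Complex.equivRealProdCLM_symm_apply]

lemma transcendental_scaledGaussian {t : ℝ} (ht : Transcendental ℚ t) {p : ℤ × ℤ}
    (hp : scaledGaussian t p ≠ 0) : Transcendental ℚ (scaledGaussian t p) := by
  intro h
  rw [scaledGaussian_apply] at h hp
  have hI : IsAlgebraic ℚ Complex.I :=
    Complex.isIntegral_rat_I.isAlgebraic
  have hw : IsAlgebraic ℚ ((p.1 : ℂ) + p.2 * Complex.I) :=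
    (isAlgebraic_intCast p.1).add ((isAlgebraic_intCast p.2).mul hI)
  have h' := h.mul hw.inv
  rw [mul_inv_cancel_right₀ (right_ne_zero_of_mul hp)] at h'
  exact ht ((isAlgebraic_algebraMap_iff (algebraMap ℝ ℂ).injective).1 h')

lemma le_of_range_scaledGaussian_le {s t : ℝ} (hs : 0 < s) (ht : 0 < t)
    (h : (scaledGaussian t).range ≤ (scaledGaussian s).range) : s ≤ t := by
  obtain ⟨p, hp⟩ := h ⟨(1, 0), rfl⟩
  have hre : s * p.1 = t := by
    simpa [scaledGaussian_apply] using congrArg Complex.re hp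
  have hpos : (0 : ℝ) < p.1 := pos_of_mul_pos_right (hre ▸ ht) hs.le
  have hone : (1 : ℝ) ≤ p.1 := by exact_mod_cast hpos
  nlinarith

lemma mk_pos_transcendental : #{t : ℝ | 0 < t ∧ Transcendental ℚ t} = continuum := by
  have hc : #{t : ℝ | IsAlgebraic ℚ t} < #(Set.Ioi (0 : ℝ)) := by
    rw [Cardinal.mk_Ioi_real]
    exact ((Algebraic.countable ℚ ℝ).le_aleph0).trans_lt aleph0_lt_continuum
  have hinf : ℵ₀ ≤ #(Set.Ioi (0 : ℝ)) := by
    rw [Cardinal.mk_Ioi_real]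
    exact aleph0_le_continuum
  refine le_antisymm ((mk_set_le _).trans_eq mk_real) ?_
  by_contra! hlt
  refine (add_lt_of_lt hinf (hlt.trans_eq (Cardinal.mk_Ioi_real 0).symm) hc).not_ge ?_
  refine (mk_le_mk_of_subset fun t ht => ?_).trans (mk_union_le _ _)
  by_cases h : IsAlgebraic ℚ t
  exacts [Or.inr h, Or.inl ⟨ht, h⟩]

theorem stmt14 :
    #{G : AddSubgroup ℂ | (∀ g ∈ G, g ≠ 0 → Transcendental ℚ g) ∧
        ∃ e : ↥G ≃+ ℤ × ℤ, Continuous e ∧ Continuous e.symm} = Cardinal.continuum := by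
  apply le_antisymm
  · have hcard : #(ℤ × ℤ → ℂ) = continuum := by simp [mk_complex]
    rw [← hcard]
    choose e _ using fun G : {G : AddSubgroup ℂ | (∀ g ∈ G, g ≠ 0 → Transcendental ℚ g) ∧
        ∃ e : ↥G ≃+ ℤ × ℤ, Continuous e ∧ Continuous e.symm} => G.2.2
    have hrange : ∀ G, Set.range (fun p => ((e G).symm p : ℂ)) = (G.1 : Set ℂ) := fun G => by
      rw [← Subtype.range_coe (s := (G.1 : Set ℂ))]
      exact (e G).symm.surjective.range_comp Subtype.val
    refine mk_le_of_injective (f := fun G p => ((e G).symm p : ℂ)) fun G H hGH => ?_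
    apply Subtype.ext
    apply SetLike.coe_injective
    rw [← hrange G, ← hrange H]
    exact congrArg Set.range hGH
  · rw [← mk_pos_transcendental]
    refine mk_le_of_injective (f := fun t => ⟨(scaledGaussian t.1).range, ?_, ?_⟩) ?_
    · rintro _ ⟨p, rfl⟩ hp
      exact transcendental_scaledGaussian t.2.2 hp
    · have hemb := isEmbedding_scaledGaussian t.2.1.ne'
      refine ⟨(AddMonoidHom.ofInjective hemb.injective).symm, ?_, continuous_of_discreteTopology⟩
      have : DiscreteTopology (scaledGaussian t.1).range :=
        hemb.toHomeomorph.symm.isEmbedding.discreteTopology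
      exact continuous_of_discreteTopology
    · intro s t hst
      have h : (scaledGaussian s.1).range = (scaledGaussian t.1).range := congrArg Subtype.val hst
      exact Subtype.ext (le_antisymm (le_of_range_scaledGaussian_le s.2.1 t.2.1 h.ge)
        (le_of_range_scaledGaussian_le t.2.1 s.2.1 h.le))
end

section
/- The set of additive subgroups G of ℂ such that every nonzero element of G is transcendental over ℚ and such that G, with its subspace topology, is homeomorphic to ℚ (with its usual topology), has cardinality 𝔠. -/
open Cardinal

/-- Multiplication by a nonzero complex number embeds `ℚ` topologically into `ℂ`. -/
lemma isEmbedding_ratCast_mul {t : ℂ} (ht : t ≠ 0) :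
    Topology.IsEmbedding (fun q : ℚ => (q : ℂ) * t) := by
  have h := (Homeomorph.mulRight₀ t ht).isEmbedding.comp
    (Complex.isometry_ofReal.isEmbedding.comp Rat.isUniformEmbedding_coe_real.isEmbedding)
  convert h using 1
  ext q
  simp

/-- A nonzero rational multiple of a transcendental number is transcendental. -/
lemma transcendental_ratCast_mul {t : ℂ} (ht : Transcendental ℚ t) {q : ℚ} (hq : q ≠ 0) :
    Transcendental ℚ ((q : ℂ) * t) := by
  intro h
  apply ht
  have hq' : IsAlgebraic ℚ ((q⁻¹ : ℚ) : ℂ) := isAlgebraic_algebraMap (q⁻¹ : ℚ)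
  have h' := hq'.mul h
  have hqc : (q : ℂ) ≠ 0 := by exact_mod_cast hq
  rwa [Rat.cast_inv, inv_mul_cancel_left₀ hqc] at h'

/-- Every transcendental number lies in a transcendental group homeomorphic to `ℚ`. -/
lemma exists_transcendental_addSubgroup_homeomorph_rat {t : ℂ} (ht : Transcendental ℚ t) :
    ∃ G : AddSubgroup ℂ, ((∀ g ∈ G, g ≠ 0 → Transcendental ℚ g) ∧ Nonempty (↥G ≃ₜ ℚ)) ∧
      t ∈ G := by
  have ht0 : t ≠ 0 := by
    rintro rfl
    exact ht isAlgebraic_zero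
  refine ⟨((AddMonoidHom.mulRight t).comp (Rat.castHom ℂ).toAddMonoidHom).range, ⟨?_, ?_⟩, 1, by simp⟩
  · rintro _ ⟨q, rfl⟩ hg
    refine transcendental_ratCast_mul ht ?_
    rintro rfl
    simp at hg
  · exact ⟨(isEmbedding_ratCast_mul ht0).toHomeomorph.symm⟩

theorem stmt16 :
    #{G : AddSubgroup ℂ | (∀ g ∈ G, g ≠ 0 → Transcendental ℚ g) ∧
        Nonempty (↥G ≃ₜ ℚ)} = Cardinal.continuum := by
  set S := {G : AddSubgroup ℂ | (∀ g ∈ G, g ≠ 0 → Transcendental ℚ g) ∧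
        Nonempty (↥G ≃ₜ ℚ)}
  let e (G : S) : ↥G.1 ≃ₜ ℚ := G.2.2.some
  apply le_antisymm
  · have hinj : Function.Injective (fun (G : S) (q : ℚ) => (((e G).symm q : ↥G.1) : ℂ)) := by
      have hr (G : S) : Set.range (fun q : ℚ => (((e G).symm q : ↥G.1) : ℂ)) = (G.1 : Set ℂ) := by
        have := (e G).symm.surjective.range_comp (Subtype.val : ↥G.1 → ℂ)
        exact this.trans Subtype.range_coe
      intro G H h
      apply Subtype.ext
      apply SetLike.coe_injective
      rw [← hr G, ← hr H]
      exact congrArg Set.range h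
    refine (mk_le_of_injective hinj).trans ?_
    simp [mk_complex]
  · have hsurj : Function.Surjective
        (Sum.elim (fun p : S × ℚ => (((e p.1).symm p.2 : ↥p.1.1) : ℂ))
          (Subtype.val : {x : ℂ // IsAlgebraic ℚ x} → ℂ)) := by
      intro t
      by_cases ht : IsAlgebraic ℚ t
      · exact ⟨Sum.inr ⟨t, ht⟩, rfl⟩
      · obtain ⟨G, hG, htG⟩ := exists_transcendental_addSubgroup_homeomorph_rat ht
        exact ⟨Sum.inl (⟨G, hG⟩, e ⟨G, hG⟩ ⟨t, htG⟩), by simp⟩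
    have hle := mk_le_of_surjective hsurj
    rw [mk_complex, mk_sum, mk_prod] at hle
    simp only [lift_id, mk_eq_aleph0 ℚ] at hle
    by_contra! hlt
    have hA : #{x : ℂ // IsAlgebraic ℚ x} < continuum :=
      (Set.Countable.le_aleph0 (Algebraic.countable ℚ ℂ)).trans_lt aleph0_lt_continuum
    exact hle.not_gt (add_lt_of_lt aleph0_le_continuum
      (mul_lt_of_lt aleph0_le_continuum hlt aleph0_lt_continuum) hA)
end

section
/- Let G be a countably infinite additive subgroup of ℂ such that every nonzero element of G is transcendental over ℚ, regarded with its subspace topology. Then exactly one of the following holds: G is isomorphic as a topological group to the discrete additive group ℤ; G is isomorphic as a topological group to the discrete additive group ℤ × ℤ; or G is homeomorphic to ℚ with its usual topology. -/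
open Set Filter Topology

/-- In a space with a basis of clopen sets, every finite set is contained in a clopen
subset of any open set containing it. -/
theorem TopologicalSpace.IsTopologicalBasis.exists_isClopen_of_finite
    {X : Type*} [TopologicalSpace X]
    (hX : TopologicalSpace.IsTopologicalBasis {s : Set X | IsClopen s}) {s u : Set X}
    (hs : s.Finite) (hu : IsOpen u) (hsu : s ⊆ u) : ∃ t, IsClopen t ∧ s ⊆ t ∧ t ⊆ u := by
  induction s, hs using Set.Finite.induction_on with
  | empty => exact ⟨∅, isClopen_empty, by simp, by simp⟩
  | @insert a s _ _ ih =>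
    obtain ⟨t, ht, hst, htu⟩ := ih ((subset_insert _ _).trans hsu)
    obtain ⟨v, hv, hav, hvu⟩ := hX.exists_subset_of_mem_open (hsu (mem_insert _ _)) hu
    exact ⟨v ∪ t, IsClopen.union hv ht, insert_subset (Or.inl hav) (hst.trans subset_union_right),
      union_subset hvu htu⟩

/-- A finite approximation to a homeomorphism `X ≃ₜ Y`: a difunctional relation matching the classes
of an open partition of `X` with those of an open partition of `Y`, and a finite partial bijection
contained in that relation. -/
structure PartialHomeo (X Y : Type*) [TopologicalSpace X] [TopologicalSpace Y] where
  rel : X → Y → Prop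
  pairs : Finset (X × Y)
  exists_right : ∀ x, ∃ y, rel x y
  exists_left : ∀ y, ∃ x, rel x y
  isOpen_left : ∀ y, IsOpen {x | rel x y}
  isOpen_right : ∀ x, IsOpen {y | rel x y}
  difunctional : ∀ {x x' y y'}, rel x y → rel x' y → rel x' y' → rel x y'
  rel_of_mem : ∀ {x y}, (x, y) ∈ pairs → rel x y
  eq_iff : ∀ {x x' y y'}, (x, y) ∈ pairs → (x', y') ∈ pairs → (x = x' ↔ y = y')

namespace PartialHomeo

variable {X Y : Type*} [TopologicalSpace X] [TopologicalSpace Y]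

instance : Preorder (PartialHomeo X Y) where
  le p q := p.pairs ⊆ q.pairs ∧ ∀ x y, q.rel x y → p.rel x y
  le_refl _ := ⟨Finset.Subset.refl _, fun _ _ h ↦ h⟩
  le_trans _ _ _ h h' := ⟨h.1.trans h'.1, fun x y hr ↦ h.2 x y (h'.2 x y hr)⟩

/-- The coarsest approximation, relating everything and matching no points. -/
def trivial [Nonempty X] [Nonempty Y] : PartialHomeo X Y where
  rel _ _ := True
  pairs := ∅
  exists_right _ := ⟨Classical.arbitrary Y, True.intro⟩
  exists_left _ := ⟨Classical.arbitrary X, True.intro⟩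
  isOpen_left _ := by simp
  isOpen_right _ := by simp
  difunctional _ _ _ := True.intro
  rel_of_mem _ := True.intro
  eq_iff h := by simp at h

/-- The approximation with the roles of the two spaces exchanged. -/
def symm (p : PartialHomeo X Y) : PartialHomeo Y X where
  rel y x := p.rel x y
  pairs := p.pairs.map (Equiv.prodComm X Y).toEmbedding
  exists_right := p.exists_left
  exists_left := p.exists_right
  isOpen_left := p.isOpen_right
  isOpen_right := p.isOpen_left
  difunctional h h' h'' := p.difunctional h'' h' h
  rel_of_mem h := p.rel_of_mem (by simpa using h)
  eq_iff h h' := (p.eq_iff (by simpa using h) (by simpa using h')).symm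

@[simp]
theorem mem_symm_pairs {p : PartialHomeo X Y} {x : X} {y : Y} :
    (y, x) ∈ p.symm.pairs ↔ (x, y) ∈ p.pairs := by
  simp [symm]

theorem symm_le_symm {p q : PartialHomeo X Y} (h : p ≤ q) : p.symm ≤ q.symm :=
  ⟨Finset.map_subset_map.2 h.1, fun y x ↦ h.2 x y⟩

theorem isCofinal_symm_preimage {s : Set (PartialHomeo Y X)} (hs : IsCofinal s) :
    IsCofinal (symm ⁻¹' s : Set (PartialHomeo X Y)) := by
  intro p
  obtain ⟨q, hq, hpq⟩ := hs p.symm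
  have h (r : PartialHomeo X Y) : r.symm.symm = r := by
    cases r
    simp only [symm, mk.injEq, true_and]
    ext
    simp
  have h' (r : PartialHomeo Y X) : r.symm.symm = r := by
    cases r
    simp only [symm, mk.injEq, true_and]
    ext
    simp
  exact ⟨q.symm, by simpa [h'] using hq, by simpa [h] using symm_le_symm hpq⟩

variable [T1Space Y] [PerfectSpace Y]

theorem infinite_right (p : PartialHomeo X Y) (x : X) : {y | p.rel x y}.Infinite := by
  obtain ⟨y, hy⟩ := p.exists_right x
  exact infinite_of_mem_nhds y ((p.isOpen_right x).mem_nhds hy)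

theorem exists_rel_forall_notMem (p : PartialHomeo X Y) (x : X) (s : Finset Y) :
    ∃ y, p.rel x y ∧ y ∉ s ∧ ∀ x', (x', y) ∉ p.pairs := by
  classical
  obtain ⟨y, hy, hy'⟩ := (p.infinite_right x).exists_notMem_finset (s ∪ p.pairs.image Prod.snd)
  simp only [Finset.mem_union, Finset.mem_image, not_or, not_exists, not_and] at hy'
  exact ⟨y, hy, hy'.1, fun x' h ↦ hy'.2 _ h rfl⟩

/-- Every approximation can be extended so as to match a given point. -/
theorem exists_le_mem_pairs (p : PartialHomeo X Y) (x : X) :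
    ∃ q, p ≤ q ∧ ∃ y, (x, y) ∈ q.pairs := by
  classical
  by_cases hx : ∃ y, (x, y) ∈ p.pairs
  · exact ⟨p, le_rfl, hx⟩
  push Not at hx
  obtain ⟨y, hy, -, hy'⟩ := p.exists_rel_forall_notMem x ∅
  refine ⟨{ p with
    pairs := insert (x, y) p.pairs
    rel_of_mem := fun {a b} h ↦ ?_
    eq_iff := fun {a a' b b'} h h' ↦ ?_ }, ⟨Finset.subset_insert _ _, fun _ _ h ↦ h⟩, y, by simp⟩
  · rcases Finset.mem_insert.1 h with h | h
    · simp_all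
    · exact p.rel_of_mem h
  · have := @p.eq_iff a a' b b'
    simp only [Finset.mem_insert, Prod.mk.injEq] at h h'
    grind

/-- Every approximation can be refined so that the class of a given point is contained in a given
neighbourhood of it. -/
theorem exists_le_subset (hX : TopologicalSpace.IsTopologicalBasis {s : Set X | IsClopen s})
    (hY : TopologicalSpace.IsTopologicalBasis {s : Set Y | IsClopen s})
    (p : PartialHomeo X Y) {x₀ : X} {u : Set X} (hu : u ∈ 𝓝 x₀) :
    ∃ q, p ≤ q ∧ ∀ y, q.rel x₀ y → ∀ x, q.rel x y → x ∈ u := by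
  classical
  obtain ⟨y₀, hy₀⟩ := p.exists_right x₀
  by_cases hsub : ∀ x, p.rel x y₀ → x ∈ u
  · exact ⟨p, le_rfl, fun y hy x hx ↦ hsub x (p.difunctional hx hy hy₀)⟩
  push Not at hsub
  obtain ⟨x₁, hx₁, hx₁u⟩ := hsub
  obtain ⟨A, hA : IsClopen A, hx₀A, hAu⟩ := hX.mem_nhds_iff.1 hu
  obtain ⟨b, hb, -, hb'⟩ := p.exists_rel_forall_notMem x₀ ∅
  obtain ⟨c, hc, hcb, hc'⟩ := p.exists_rel_forall_notMem x₀ {b}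
  have hs : (insert b (Prod.snd '' {z ∈ (p.pairs : Set (X × Y)) | z.1 ∈ A})).Finite :=
    ((p.pairs.finite_toSet.subset (sep_subset _ _)).image _).insert _
  have ht : (insert c (Prod.snd '' {z ∈ (p.pairs : Set (X × Y)) | z.1 ∉ A})).Finite :=
    ((p.pairs.finite_toSet.subset (sep_subset _ _)).image _).insert _
  obtain ⟨B, hB, hsB, hBt⟩ := hY.exists_isClopen_of_finite hs ht.isClosed.isOpen_compl (by
    rintro y (rfl | ⟨⟨a, y⟩, ⟨ha, haA⟩, rfl⟩) (h | ⟨⟨a', y'⟩, ⟨ha', haA'⟩, h⟩)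
    · exact hcb (by simp [h])
    · exact hb' a' (by simpa [← h] using ha')
    · exact hc' a (by simpa [← h] using ha)
    · obtain rfl := (p.eq_iff ha' ha).2 h
      exact haA' haA)
  have hbB : b ∈ B := hsB (mem_insert _ _)
  have hcB : c ∉ B := fun h ↦ hBt h (mem_insert _ _)
  have hmem : ∀ {x y}, (x, y) ∈ p.pairs → (x ∈ A ↔ y ∈ B) := fun {x y} h ↦
    ⟨fun hx ↦ hsB (Or.inr ⟨(x, y), ⟨h, hx⟩, rfl⟩),
      fun hy ↦ by_contra fun hx ↦ hBt hy (Or.inr ⟨(x, y), ⟨h, hx⟩, rfl⟩)⟩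
  have hd := @p.difunctional
  refine ⟨{ rel := fun x y ↦ p.rel x y ∧ (p.rel x y₀ → (x ∈ A ↔ y ∈ B))
            pairs := p.pairs
            exists_right := fun x ↦ ?_
            exists_left := fun y ↦ ?_
            isOpen_left := fun y ↦ ?_
            isOpen_right := fun x ↦ ?_
            difunctional := fun {x x' y y'} h h' h'' ↦ ?_
            rel_of_mem := fun h ↦ ⟨p.rel_of_mem h, fun _ ↦ hmem h⟩
            eq_iff := p.eq_iff }, ⟨Finset.Subset.refl _, fun _ _ h ↦ h.1⟩, fun y hy x hx ↦ ?_⟩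
  · by_cases hx : p.rel x y₀
    · by_cases hxA : x ∈ A
      · exact ⟨b, hd hx hy₀ hb, fun _ ↦ by simp [hxA, hbB]⟩
      · exact ⟨c, hd hx hy₀ hc, fun _ ↦ by simp [hxA, hcB]⟩
    · obtain ⟨y, hy⟩ := p.exists_right x
      exact ⟨y, hy, fun h ↦ absurd h hx⟩
  · by_cases hy : p.rel x₀ y
    · by_cases hyB : y ∈ B
      · exact ⟨x₀, hy, fun _ ↦ by simp [hyB, hx₀A]⟩
      · exact ⟨x₁, hd hx₁ hy₀ hy, fun _ ↦ by simp [hyB, show x₁ ∉ A from fun h ↦ hx₁u (hAu h)]⟩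
    · obtain ⟨x, hx⟩ := p.exists_left y
      exact ⟨x, hx, fun h ↦ absurd (hd hy₀ h hx) hy⟩
  · by_cases hy : p.rel x₀ y
    · have key : {x | p.rel x y ∧ (p.rel x y₀ → (x ∈ A ↔ y ∈ B))} =
          {x | p.rel x y} ∩ {x | x ∈ A ↔ y ∈ B} := by
        ext x
        exact and_congr_right fun hx ↦ by simp [hd hx hy hy₀]
      rw [key]
      refine (p.isOpen_left y).inter ?_
      by_cases hyB : y ∈ B
      · simpa [hyB] using hA.isOpen
      · simp only [hyB, iff_false]
        exact hA.compl.isOpen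
    · have key : {x | p.rel x y ∧ (p.rel x y₀ → (x ∈ A ↔ y ∈ B))} = {x | p.rel x y} := by
        ext x
        exact and_iff_left_of_imp fun hx h ↦ absurd (hd hy₀ h hx) hy
      rw [key]
      exact p.isOpen_left y
  · refine (p.isOpen_right x).inter (t := {y | p.rel x y₀ → (x ∈ A ↔ y ∈ B)}) ?_
    by_cases hx : p.rel x y₀
    · by_cases hxA : x ∈ A
      · simp only [hx, hxA, forall_const, true_iff]
        exact hB.isOpen
      · simp only [hx, hxA, forall_const, false_iff]
        exact hB.compl.isOpen
    · simp [hx]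
  · grind
  · exact hAu ((hx.2 (hd hx.1 hy.1 hy₀)).2 ((hy.2 hy₀).1 hx₀A))

/-- The approximations that match the point `x` and whose class of `x` is contained in `u`. -/
def localizing (x : X) (u : Set X) : Set (PartialHomeo X Y) :=
  {p | (∃ y, (x, y) ∈ p.pairs) ∧ ∀ y, p.rel x y → ∀ x', p.rel x' y → x' ∈ u}

theorem isCofinal_localizing (hX : TopologicalSpace.IsTopologicalBasis {s : Set X | IsClopen s})
    (hY : TopologicalSpace.IsTopologicalBasis {s : Set Y | IsClopen s})
    {x : X} {u : Set X} (hu : u ∈ 𝓝 x) :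
    IsCofinal (localizing x u : Set (PartialHomeo X Y)) := by
  intro p
  obtain ⟨q, hpq, hq⟩ := p.exists_le_subset hX hY hu
  obtain ⟨r, hqr, hr⟩ := q.exists_le_mem_pairs x
  exact ⟨r, ⟨hr, fun y hy x' hx' ↦ hq y (hqr.2 _ _ hy) x' (hqr.2 _ _ hx')⟩, hpq.trans hqr⟩

end PartialHomeo

open PartialHomeo in
/-- **Sierpiński's theorem**: nonempty countable first countable completely regular `T₁` spaces
without isolated points are homeomorphic. -/
theorem nonempty_homeomorph_of_countable_perfect (X Y : Type*) [TopologicalSpace X]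
    [TopologicalSpace Y] [T35Space X] [T35Space Y] [FirstCountableTopology X]
    [FirstCountableTopology Y] [PerfectSpace X] [PerfectSpace Y] [Countable X] [Countable Y]
    [Nonempty X] [Nonempty Y] : Nonempty (X ≃ₜ Y) := by
  have hX := CompletelyRegularSpace.isTopologicalBasis_clopens_of_cardinalMk_lt_continuum
    (X := X) ((Cardinal.mk_le_aleph0 (α := X)).trans_lt Cardinal.aleph0_lt_continuum)
  have hY := CompletelyRegularSpace.isTopologicalBasis_clopens_of_cardinalMk_lt_continuum
    (X := Y) ((Cardinal.mk_le_aleph0 (α := Y)).trans_lt Cardinal.aleph0_lt_continuum)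
  choose u hu using fun x : X ↦ (𝓝 x).exists_antitone_basis
  choose v hv using fun y : Y ↦ (𝓝 y).exists_antitone_basis
  let _ := Encodable.ofCountable (X × ℕ ⊕ Y × ℕ)
  let D : X × ℕ ⊕ Y × ℕ → Order.Cofinal (PartialHomeo X Y) := Sum.elim
    (fun i ↦ ⟨_, isCofinal_localizing hX hY ((hu i.1).mem i.2)⟩)
    (fun i ↦ ⟨_, isCofinal_symm_preimage (isCofinal_localizing hY hX ((hv i.1).mem i.2))⟩)
  let I := Order.idealOfCofinals PartialHomeo.trivial D
  have hrel : ∀ p ∈ I, ∀ q ∈ I, ∀ x y, (x, y) ∈ q.pairs → p.rel x y := by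
    intro p hp q hq x y h
    obtain ⟨r, -, hpr, hqr⟩ := I.directed p hp q hq
    exact hpr.2 _ _ (r.rel_of_mem (hqr.1 h))
  have heq : ∀ p ∈ I, ∀ q ∈ I, ∀ x x' y y', (x, y) ∈ p.pairs → (x', y') ∈ q.pairs →
      (x = x' ↔ y = y') := by
    intro p hp q hq x x' y y' h h'
    obtain ⟨r, -, hpr, hqr⟩ := I.directed p hp q hq
    exact r.eq_iff (hpr.1 h) (hqr.1 h')
  have hDX (x : X) (n : ℕ) : ∃ p ∈ I, p ∈ localizing x (u x n) := by
    obtain ⟨p, hp, hpI⟩ := Order.cofinal_meets_idealOfCofinals PartialHomeo.trivial D (.inl (x, n))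
    exact ⟨p, hpI, hp⟩
  have hDY (y : Y) (n : ℕ) : ∃ p ∈ I, p.symm ∈ localizing y (v y n) := by
    obtain ⟨p, hp, hpI⟩ := Order.cofinal_meets_idealOfCofinals PartialHomeo.trivial D (.inr (y, n))
    exact ⟨p, hpI, hp⟩
  have hf (x : X) : ∃ y, ∃ p ∈ I, (x, y) ∈ p.pairs := by
    obtain ⟨p, hp, ⟨y, hy⟩, -⟩ := hDX x 0
    exact ⟨y, p, hp, hy⟩
  have hg (y : Y) : ∃ x, ∃ p ∈ I, (x, y) ∈ p.pairs := by
    obtain ⟨p, hp, ⟨x, hx⟩, -⟩ := hDY y 0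
    exact ⟨x, p, hp, mem_symm_pairs.1 hx⟩
  choose f hf using hf
  choose g hg using hg
  refine ⟨⟨⟨f, g, fun x ↦ ?_, fun y ↦ ?_⟩, ?_, ?_⟩⟩
  · obtain ⟨p, hp, h⟩ := hf x
    obtain ⟨q, hq, h'⟩ := hg (f x)
    exact (heq q hq p hp _ _ _ _ h' h).2 rfl
  · obtain ⟨p, hp, h⟩ := hg y
    obtain ⟨q, hq, h'⟩ := hf (g y)
    exact (heq q hq p hp _ _ _ _ h' h).1 rfl
  · refine continuous_iff_continuousAt.2 fun x ↦ (hv (f x)).tendsto_right_iff.2 fun n _ ↦ ?_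
    obtain ⟨p, hp, -, h⟩ := hDY (f x) n
    have hr (x : X) : p.rel x (f x) := (hf x).elim fun q hq ↦ hrel p hp q hq.1 _ _ hq.2
    filter_upwards [(p.isOpen_left (f x)).mem_nhds (hr x)] with x' hx'
    exact h x' hx' _ (hr x')
  · refine continuous_iff_continuousAt.2 fun y ↦ (hu (g y)).tendsto_right_iff.2 fun n _ ↦ ?_
    obtain ⟨p, hp, -, h⟩ := hDX (g y) n
    have hr (y : Y) : p.rel (g y) y := (hg y).elim fun q hq ↦ hrel p hp q hq.1 _ _ hq.2
    filter_upwards [(p.isOpen_right (g y)).mem_nhds (hr y)] with y' hy'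
    exact h y' hy' _ (hr y')

theorem AddSubgroup.nonempty_addEquiv_of_discrete (G : AddSubgroup ℂ) [DiscreteTopology G]
    [Infinite G] : Nonempty (G ≃+ ℤ) ∨ Nonempty (G ≃+ ℤ × ℤ) := by
  let L := AddSubgroup.toIntSubmodule G
  have hL : DiscreteTopology L := ‹DiscreteTopology G›
  have hi : Infinite L := ‹Infinite G›
  have hle : Module.finrank ℤ L ≤ 2 := by
    have hd : DiscreteTopology (Submodule.span ℤ (L : Set ℂ)) := by
      rw [Submodule.span_eq]
      exact hL
    have h := Real.finrank_eq_int_finrank_of_discrete hd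
    have h' : Set.finrank ℝ (L : Set ℂ) ≤ Module.finrank ℝ ℂ := Submodule.finrank_le _
    rwa [h, Set.finrank, Submodule.span_eq, Complex.finrank_real_complex] at h'
  have hpos : 0 < Module.finrank ℤ L := Module.finrank_pos
  obtain h | h : Module.finrank ℤ L = 1 ∨ Module.finrank ℤ L = 2 := by omega
  · exact .inl ⟨(LinearEquiv.ofFinrankEq L ℤ (h.trans (Module.finrank_self ℤ).symm)).toAddEquiv⟩
  · exact .inr ⟨(LinearEquiv.ofFinrankEq L (ℤ × ℤ) (h.trans (by simp))).toAddEquiv⟩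

theorem perfectSpace_of_not_discreteTopology {G : Type*} [AddGroup G] [TopologicalSpace G]
    [IsTopologicalAddGroup G] (h : ¬ DiscreteTopology G) : PerfectSpace G := by
  refine perfectSpace_iff_forall_not_isolated.2 fun x ↦ ⟨fun hx ↦ h ?_⟩
  have hx' : IsOpen {x} := (isOpen_singleton_iff_punctured_nhds x).2 hx
  refine discreteTopology_of_isOpen_singleton_zero ?_
  simpa using hx'.preimage (continuous_const_add x)

theorem isEmpty_int_addEquiv_int_prod_int : IsEmpty (ℤ ≃+ ℤ × ℤ) :=
  ⟨fun e ↦ by simpa using e.toIntLinearEquiv.finrank_eq⟩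

theorem not_discreteTopology_rat : ¬ DiscreteTopology ℚ := fun _ ↦
  not_isOpen_singleton (0 : ℚ) (isOpen_discrete _)

theorem stmt17 (G : AddSubgroup ℂ)
    (htrans : ∀ g ∈ G, g ≠ 0 → Transcendental ℚ g)
    (hc : Countable ↥G) (hi : Infinite ↥G) :
    let P := ∃ e : ↥G ≃+ ℤ, Continuous e ∧ Continuous e.symm
    let Q := ∃ e : ↥G ≃+ ℤ × ℤ, Continuous e ∧ Continuous e.symm
    let R := Nonempty (↥G ≃ₜ ℚ)
    (P ∧ ¬Q ∧ ¬R) ∨ (¬P ∧ Q ∧ ¬R) ∨ (¬P ∧ ¬Q ∧ R) := by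
  intro P Q R
  have hPQ : P → ¬ Q := fun ⟨e, _⟩ ⟨e', _⟩ ↦
    isEmpty_int_addEquiv_int_prod_int.false (e.symm.trans e')
  by_cases hG : DiscreteTopology G
  · have hR : ¬ R := fun ⟨e⟩ ↦ not_discreteTopology_rat e.discreteTopology
    have h : P ∨ Q := G.nonempty_addEquiv_of_discrete.imp
      (fun ⟨e⟩ ↦ ⟨e, continuous_of_discreteTopology, continuous_of_discreteTopology⟩)
      (fun ⟨e⟩ ↦ ⟨e, continuous_of_discreteTopology, continuous_of_discreteTopology⟩)
    exact h.imp (fun hP ↦ ⟨hP, hPQ hP, hR⟩) fun hQ ↦ .inl ⟨fun hP ↦ hPQ hP hQ, hQ, hR⟩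
  · have hP : ¬ P := fun ⟨e, h, _⟩ ↦ hG (.of_continuous_injective h e.injective)
    have hQ : ¬ Q := fun ⟨e, h, _⟩ ↦ hG (.of_continuous_injective h e.injective)
    have : PerfectSpace G := perfectSpace_of_not_discreteTopology hG
    have : PerfectSpace ℚ := perfectSpace_of_not_discreteTopology not_discreteTopology_rat
    exact .inr (.inr ⟨hP, hQ, nonempty_homeomorph_of_countable_perfect G ℚ⟩)
end

section
/- There exists a family, of cardinality 2^𝔠, of additive subgroups of ℂ, each with every nonzero element transcendental over ℚ, such that no two distinct members of the family are homeomorphic when given their subspace topologies (in particular, no two are isomorphic as topological groups). -/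
open Cardinal

/-- There are at most continuum many continuous complex-valued functions on a separable space. -/
theorem mk_continuousMap_complex_le_continuum (X : Type) [TopologicalSpace X]
    [TopologicalSpace.SeparableSpace X] : #C(X, ℂ) ≤ 𝔠 := by
  obtain ⟨D, hDc, hD⟩ := TopologicalSpace.exists_countable_dense X
  have hinj : Function.Injective fun (f : C(X, ℂ)) (d : D) => f d := fun f g h =>
    ContinuousMap.coe_injective <|
      Continuous.ext_on hD f.continuous g.continuous fun d hd => congrFun h ⟨d, hd⟩
  calc #C(X, ℂ) ≤ #(D → ℂ) := mk_le_of_injective hinj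
    _ = 𝔠 ^ #D := by simp
    _ ≤ 𝔠 ^ ℵ₀ := power_le_power_left continuum_ne_zero hDc.le_aleph0
    _ = 𝔠 := continuum_power_aleph0

theorem mk_addSubgroup_homeomorph_le_continuum (G : AddSubgroup ℂ) :
    #{H : AddSubgroup ℂ // Nonempty (G ≃ₜ H)} ≤ 𝔠 := by
  refine (mk_le_of_injective (f := fun H : {H : AddSubgroup ℂ // Nonempty (G ≃ₜ H)} =>
    (⟨fun x => (H.2.some x : ℂ), by fun_prop⟩ : C(G, ℂ))) fun H K h => ?_).trans
      (mk_continuousMap_complex_le_continuum G)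
  have hrange (L : {H : AddSubgroup ℂ // Nonempty (G ≃ₜ H)}) :
      Set.range (fun x => (L.2.some x : ℂ)) = (L.1 : Set ℂ) :=
    (L.2.some.surjective.range_comp Subtype.val).trans Subtype.range_coe
  apply Subtype.ext
  apply SetLike.coe_injective
  rw [← hrange H, ← hrange K]
  exact congrArg (fun f : C(G, ℂ) => Set.range f) h

/-- A rational subspace of `ℂ` of dimension the continuum without nonzero algebraic numbers. -/
theorem exists_submodule_transcendental :
    ∃ V : Submodule ℚ ℂ, Module.rank ℚ V = 𝔠 ∧ ∀ x ∈ V, x ≠ 0 → Transcendental ℚ x := by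
  let A : Submodule ℚ ℂ := (Subalgebra.algebraicClosure ℚ ℂ).toSubmodule
  obtain ⟨V, hV⟩ := A.exists_isCompl
  have hA : #A ≤ ℵ₀ := (Algebraic.countable ℚ ℂ).le_aleph0
  have hcard : #V = 𝔠 := by
    refine le_antisymm ((mk_subtype_le _).trans mk_complex.le) ?_
    by_contra! h
    have hprod : #A * #V = 𝔠 := by
      rw [← mk_complex, ← mk_congr (A.prodEquivOfIsCompl V hV).toEquiv, mk_prod, lift_id, lift_id]
    exact (mul_lt_of_lt aleph0_le_continuum (hA.trans_lt aleph0_lt_continuum) h).ne hprod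
  refine ⟨V, ?_, fun x hx hx0 halg => hx0 ?_⟩
  · rw [Module.Free.rank_eq_mk_of_infinite_lt ℚ V (by simp [hcard, aleph0_lt_continuum]), hcard]
  · exact (Submodule.disjoint_def.mp hV.disjoint) x halg hx

theorem exists_mk_transcendental_addSubgroup :
    ∃ 𝒮 : Set (AddSubgroup ℂ), #𝒮 = 2 ^ 𝔠 ∧
      ∀ G ∈ 𝒮, ∀ g ∈ G, g ≠ 0 → Transcendental ℚ g := by
  obtain ⟨V, hrank, hV⟩ := exists_submodule_transcendental
  let b := Module.Free.chooseBasis ℚ V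
  let v : Module.Free.ChooseBasisIndex ℚ V → ℂ := fun i => b i
  have hv : LinearIndependent ℚ v := b.linearIndependent.map' V.subtype V.ker_subtype
  let F : Set (Module.Free.ChooseBasisIndex ℚ V) → AddSubgroup ℂ := fun s =>
    (Submodule.span ℚ (v '' s)).toAddSubgroup
  have hmem (s i) : v i ∈ F s ↔ i ∈ s :=
    ⟨fun h => by_contra fun hi => hv.notMem_span_image hi h,
      fun h => Submodule.subset_span (Set.mem_image_of_mem v h)⟩
  have hF : Function.Injective F := fun s t h => by
    ext i
    rw [← hmem s, ← hmem t, h]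
  refine ⟨Set.range F, ?_, ?_⟩
  · rw [mk_range_eq F hF, mk_set, ← Module.Free.rank_eq_card_chooseBasisIndex, hrank]
  · rintro _ ⟨s, rfl⟩ g hg
    refine hV g (Submodule.span_le.mpr ?_ hg)
    rintro _ ⟨i, -, rfl⟩
    exact (b i).2

/-- A family of `2 ^ 𝔠` objects whose equivalence classes have size at most `𝔠` has `2 ^ 𝔠`
equivalence classes. -/
theorem mk_quotient_eq_two_power_continuum {α : Type} (r : Setoid α) (hα : #α = 2 ^ 𝔠)
    (hr : ∀ a, #{x // r a x} ≤ 𝔠) : #(Quotient r) = 2 ^ 𝔠 := by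
  refine le_antisymm (hα ▸ mk_quotient_le) ?_
  by_contra! h
  have hle : #α ≤ #(Quotient r) * 𝔠 := by
    refine mk_le_mk_mul_of_mk_preimage_le (Quotient.mk r) fun q => ?_
    induction q using Quotient.inductionOn with
    | h a =>
      refine le_trans (mk_le_mk_of_subset fun x hx => ?_) (hr a)
      exact r.symm (Quotient.exact hx)
  exact (hle.trans_lt (mul_lt_of_lt (aleph0_le_continuum.trans (cantor 𝔠).le) h (cantor 𝔠))).ne hα

theorem stmt18 :
    ∃ 𝒢 : Set (AddSubgroup ℂ),
      #↥𝒢 = 2 ^ Cardinal.continuum ∧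
      (∀ G ∈ 𝒢, ∀ g ∈ G, g ≠ 0 → Transcendental ℚ g) ∧
      (∀ G ∈ 𝒢, ∀ H ∈ 𝒢, G ≠ H → IsEmpty (↥G ≃ₜ ↥H)) := by
  obtain ⟨𝒮, hcard, htrans⟩ := exists_mk_transcendental_addSubgroup
  let r : Setoid 𝒮 :=
    { r := fun G H => Nonempty (G.1 ≃ₜ H.1)
      iseqv := ⟨fun G => ⟨Homeomorph.refl G.1⟩, fun ⟨e⟩ => ⟨e.symm⟩,
        fun ⟨e⟩ ⟨f⟩ => ⟨e.trans f⟩⟩ }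
  have hclass (G : 𝒮) : #{H // r G H} ≤ 𝔠 :=
    (mk_le_of_injective (f := fun H : {H // r G H} =>
      (⟨H.1.1, H.2⟩ : {H : AddSubgroup ℂ // Nonempty (G.1 ≃ₜ H)})) fun H K h =>
        Subtype.ext (Subtype.ext (Subtype.mk.inj h))).trans
      (mk_addSubgroup_homeomorph_le_continuum G.1)
  let rep : Quotient r → AddSubgroup ℂ := fun q => q.out.1
  refine ⟨Set.range rep, ?_, ?_, ?_⟩
  · rw [mk_range_eq rep (Subtype.val_injective.comp Quotient.out_injective)]
    exact mk_quotient_eq_two_power_continuum r hcard hclass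
  · rintro _ ⟨q, rfl⟩
    exact htrans _ q.out.2
  · rintro _ ⟨p, rfl⟩ _ ⟨q, rfl⟩ hne
    refine ⟨fun e => hne ?_⟩
    have hpq : p = q := Quotient.out_equiv_out.mp ⟨e⟩
    rw [hpq]
end
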